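/- Let n ≥ 2. Every partial proper edge coloring of at most n−1 edges of the complete graph K_{2n} is extendable to a proper (2n−1)-edge coloring of K_{2n}. -/

import Mathlib

open SimpleGraph

variable {V : Type*}

/-- Two edges of `G` are adjacent if both are edges, they are distinct,
and they share a vertex. -/
def EdgeAdj (G : SimpleGraph V) (e f : Sym2 V) : Prop :=
  e ∈ G.edgeSet ∧ f ∈ G.edgeSet ∧ e ≠ f ∧ ∃ v, v ∈ e ∧ v ∈ f

/-- A proper edge coloring (with natural-number colors). -/
def IsProperEdgeColoring (G : SimpleGraph V) (C : Sym2 V → ℕ) : Prop :=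
  ∀ ⦃e f⦄, EdgeAdj G e f → C e ≠ C f

/-- A partial proper edge coloring: colored edges are edges of `G`, and
adjacent colored edges receive distinct colors. -/
def IsPartialProperEdgeColoring (G : SimpleGraph V) (φ : Sym2 V → Option ℕ) : Prop :=
  (∀ e, φ e ≠ none → e ∈ G.edgeSet) ∧
  ∀ ⦃e f⦄, EdgeAdj G e f → φ e ≠ none → φ e ≠ φ f

/-- The partial coloring uses colors from `{0, ..., t-1}`. -/
def UsesColors (φ : Sym2 V → Option ℕ) (t : ℕ) : Prop :=
  ∀ e a, φ e = some a → a < t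

/-- The (total) coloring uses colors from `{0, ..., t-1}` on all edges of `G`. -/
def ColorsBelow (G : SimpleGraph V) (C : Sym2 V → ℕ) (t : ℕ) : Prop :=
  ∀ e ∈ G.edgeSet, C e < t

/-- `C` agrees with the partial coloring `φ` on all precolored edges. -/
def ExtendsColoring (C : Sym2 V → ℕ) (φ : Sym2 V → Option ℕ) : Prop :=
  ∀ e a, φ e = some a → C e = a

/-- `φ` extends to a proper edge coloring of `G` with `t` colors. -/
def Extendable (G : SimpleGraph V) (φ : Sym2 V → Option ℕ) (t : ℕ) : Prop :=
  ∃ C, IsProperEdgeColoring G C ∧ ColorsBelow G C t ∧ ExtendsColoring C φ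

/-- The set of precolored edges of `φ`. -/
def Precolored (φ : Sym2 V → Option ℕ) : Set (Sym2 V) := {e | φ e ≠ none}

/-- The chromatic index: least `t` admitting a proper edge coloring with `t` colors. -/
noncomputable def chromaticIndex (G : SimpleGraph V) : ℕ :=
  sInf {t | ∃ C, IsProperEdgeColoring G C ∧ ColorsBelow G C t}

/-- A set of edges is independent (a matching) if no two distinct members share a vertex. -/
def IndependentEdges (S : Set (Sym2 V)) : Prop :=
  ∀ e ∈ S, ∀ f ∈ S, e ≠ f → ∀ v, v ∈ e → v ∉ f

/-- The vertices reached by the alternating chains of the Mendelsohn–Dulmage argument. -/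
inductive AlternatingChain {ι κ : Type*} (f : ι → κ) (g : κ → ι) (W : Set κ) : κ → Prop
  | base (w : κ) (hw : w ∈ W) (hf : w ∉ Set.range f) : AlternatingChain f g W w
  | step (w : κ) (h : AlternatingChain f g W w) (hw : f (g w) ∈ W) :
      AlternatingChain f g W (f (g w))

theorem AlternatingChain.mem {ι κ : Type*} {f : ι → κ} {g : κ → ι} {W : Set κ} {w : κ}
    (h : AlternatingChain f g W w) : w ∈ W := by
  cases h <;> assumption

/-- The Mendelsohn–Dulmage theorem: a matching saturating one side and a matching saturating a
subset `W` of the other side give a matching saturating both. -/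
theorem exists_injective_covering {ι κ : Type*} (r : ι → κ → Prop) (f : ι → κ)
    (hf : Function.Injective f) (hfr : ∀ i, r i (f i)) (W : Set κ) (g : κ → ι)
    (hg : Set.InjOn g W) (hgr : ∀ w ∈ W, r (g w) w) :
    ∃ f' : ι → κ, Function.Injective f' ∧ (∀ i, r i (f' i)) ∧ W ⊆ Set.range f' := by
  classical
  set Z : κ → Prop := AlternatingChain f g W with hZ
  have key : ∀ i, ∀ z, Z z → f i = z → ∃ w, Z w ∧ g w = i := by
    intro i z hz hi
    cases hz with
    | base _ _ hn => exact absurd ⟨i, hi⟩ hn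
    | step w h _ => exact ⟨w, h, (hf hi).symm⟩
  have hpick : ∀ i, ∃ k, (∃ w, Z w ∧ g w = i ∧ k = w) ∨ ((¬ ∃ w, Z w ∧ g w = i) ∧ k = f i) := by
    intro i
    by_cases h : ∃ w, Z w ∧ g w = i
    · obtain ⟨w, hw, hi⟩ := h
      exact ⟨w, Or.inl ⟨w, hw, hi, rfl⟩⟩
    · exact ⟨f i, Or.inr ⟨h, rfl⟩⟩
  choose f' hf' using hpick
  refine ⟨f', ?_, ?_, ?_⟩
  · intro i j hij
    rcases hf' i with ⟨w, hw, hi, hk⟩ | ⟨hi, hk⟩ <;> rcases hf' j with ⟨w', hw', hj, hk'⟩ | ⟨hj, hk'⟩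
    · rw [← hi, ← hj, ← hk, ← hk', hij]
    · exact absurd (key j w hw (by rw [← hk, ← hk', hij])) hj
    · exact absurd (key i w' hw' (by rw [← hk, ← hk', hij])) hi
    · exact hf (by rw [← hk, ← hk', hij])
  · intro i
    rcases hf' i with ⟨w, hw, hi, hk⟩ | ⟨_, hk⟩
    · rw [hk, ← hi]; exact hgr w hw.mem
    · rw [hk]; exact hfr i
  · intro w hw
    by_cases hz : Z w
    · refine ⟨g w, ?_⟩
      rcases hf' (g w) with ⟨w', hw', hi, hk⟩ | ⟨h, _⟩
      · rw [hk]; exact hg hw'.mem hw hi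
      · exact absurd ⟨w, hz, rfl⟩ h
    · have hr : w ∈ Set.range f := by
        by_contra hn
        exact hz (.base w hw hn)
      obtain ⟨i, hi⟩ := hr
      refine ⟨i, ?_⟩
      rcases hf' i with ⟨w', hw', hi', hk⟩ | ⟨_, hk⟩
      · exfalso
        apply hz
        have := AlternatingChain.step (f := f) (g := g) (W := W) w' hw' (by rw [hi', hi]; exact hw)
        rwa [hi', hi] at this
      · rw [hk, hi]

open Finset in
/-- A bipartite graph satisfying the two cut conditions has a subgraph that is `d`-regular on one
side and has degrees between `l` and `q` on the other side. -/
theorem exists_subgraph_degrees {α β : Type*} [DecidableEq α] [DecidableEq β]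
    (A : Finset α) (B : Finset β) (E : Finset (α × β)) (hE : E ⊆ A ×ˢ B) (d : ℕ) (q l : β → ℕ)
    (hlq : ∀ b, l b ≤ q b)
    (h1 : ∀ X ⊆ A, ∀ Y ⊆ B, d * #X ≤ ∑ b ∈ Y, q b + #{e ∈ E | e.1 ∈ X ∧ e.2 ∉ Y})
    (h2 : ∀ X ⊆ A, ∀ Y ⊆ B, ∑ b ∈ Y, l b ≤ d * #X + #{e ∈ E | e.1 ∉ X ∧ e.2 ∈ Y}) :
    ∃ H ⊆ E, (∀ a ∈ A, #{e ∈ H | e.1 = a} = d) ∧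
      ∀ b ∈ B, l b ≤ #{e ∈ H | e.2 = b} ∧ #{e ∈ H | e.2 = b} ≤ q b := by
  classical
  set deg : α → ℕ := fun a => #{e ∈ E | e.1 = a} with hdeg
  have hd : ∀ a ∈ A, d ≤ deg a := by
    intro a ha
    have := h1 {a} (by simpa using ha) ∅ (by simp)
    simpa [hdeg] using this
  have hsum : ∀ X : Finset α, #{e ∈ E | e.1 ∈ X} = ∑ a ∈ X, deg a := by
    intro X
    rw [card_eq_sum_card_fiberwise (f := Prod.fst) (t := X) (by intro e he; simp at he; exact he.2)]
    refine sum_congr rfl fun a ha => ?_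
    rw [filter_filter]
    congr 1
    ext e
    simp only [mem_filter]
    constructor
    · rintro ⟨h, _, h'⟩; exact ⟨h, h'⟩
    · rintro ⟨h, h'⟩; exact ⟨h, h' ▸ ha, h'⟩
  have hsub : ∀ X ⊆ A, ∑ a ∈ X, (deg a - d) + d * #X = ∑ a ∈ X, deg a := by
    intro X hX
    rw [mul_comm, ← smul_eq_mul, ← sum_const, ← sum_add_distrib]
    exact sum_congr rfl fun a ha => Nat.sub_add_cancel (hd a (hX ha))
  let t : E → Finset ((Σ _ : α, ℕ) ⊕ (Σ _ : β, ℕ)) := fun e =>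
    (({e.1.1} : Finset α).sigma fun a => range (deg a - d)).disjSum
      (({e.1.2} : Finset β).sigma fun b => range (q b))
  obtain ⟨f, hf, hft⟩ := (all_card_le_biUnion_card_iff_exists_injective t).1 (by
    intro s
    set X : Finset α := s.image fun e => e.1.1 with hX
    set Y : Finset β := s.image fun e => e.1.2 with hY
    have hXA : X ⊆ A := by
      intro a ha
      obtain ⟨e, _, rfl⟩ := mem_image.1 ha
      exact (mem_product.1 (hE e.2)).1
    have hYB : Y ⊆ B := by
      intro a ha
      obtain ⟨e, _, rfl⟩ := mem_image.1 ha
      exact (mem_product.1 (hE e.2)).2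
    have hsup : (X.sigma fun a => range (deg a - d)).disjSum (Y.sigma fun b => range (q b)) ⊆
        s.biUnion t := by
      intro w hw
      rw [mem_biUnion]
      rcases w with ⟨a, j⟩ | ⟨b, j⟩
      · rw [inl_mem_disjSum, mem_sigma] at hw
        obtain ⟨e, he, h⟩ := mem_image.1 hw.1
        refine ⟨e, he, ?_⟩
        simp only [t, inl_mem_disjSum, mem_sigma, mem_singleton]
        exact ⟨h.symm, hw.2⟩
      · rw [inr_mem_disjSum, mem_sigma] at hw
        obtain ⟨e, he, h⟩ := mem_image.1 hw.1
        refine ⟨e, he, ?_⟩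
        simp only [t, inr_mem_disjSum, mem_sigma, mem_singleton]
        exact ⟨h.symm, hw.2⟩
    have hc := card_le_card hsup
    rw [card_disjSum, card_sigma, card_sigma] at hc
    simp only [card_range] at hc
    have hs : #s ≤ #{e ∈ E | e.1 ∈ X ∧ e.2 ∈ Y} := by
      refine card_le_card_of_injOn (fun e => e.1) ?_ (fun _ _ _ _ h => Subtype.ext h)
      intro e he
      simp only [coe_filter, Set.mem_ofPred_eq]
      exact ⟨e.2, mem_image_of_mem _ he, mem_image_of_mem _ he⟩
    have hsplit : #{e ∈ E | e.1 ∈ X ∧ e.2 ∈ Y} + #{e ∈ E | e.1 ∈ X ∧ e.2 ∉ Y} =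
        #{e ∈ E | e.1 ∈ X} := by
      rw [← filter_filter, ← filter_filter]
      exact card_filter_add_card_filter_not _
    have := h1 X hXA Y hYB
    have := hsum X
    have := hsub X hXA
    omega)
  set W : Finset ((Σ _ : α, ℕ) ⊕ (Σ _ : β, ℕ)) :=
    (A.sigma fun a => range (deg a - d)).disjSum (B.sigma fun b => range (l b)) with hW
  let u : W → Finset (α × β) := fun w =>
    Sum.elim (fun p => {e ∈ E | e.1 = p.1}) (fun p => {e ∈ E | e.2 = p.1}) w.1
  obtain ⟨g, hg, hgu⟩ := (all_card_le_biUnion_card_iff_exists_injective u).1 (by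
    intro s
    set X : Finset α := {a ∈ A | ∃ j, Sum.inl ⟨a, j⟩ ∈ s.image Subtype.val} with hX
    set Y : Finset β := {b ∈ B | ∃ j, Sum.inr ⟨b, j⟩ ∈ s.image Subtype.val} with hY
    have hs : s.image Subtype.val ⊆
        (X.sigma fun a => range (deg a - d)).disjSum (Y.sigma fun b => range (l b)) := by
      intro w hw
      have hwW : w ∈ W := by
        obtain ⟨w', _, rfl⟩ := mem_image.1 hw
        exact w'.2
      rcases w with ⟨a, j⟩ | ⟨b, j⟩
      · simp only [hW, inl_mem_disjSum, mem_sigma] at hwW ⊢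
        exact ⟨mem_filter.2 ⟨hwW.1, j, hw⟩, hwW.2⟩
      · simp only [hW, inr_mem_disjSum, mem_sigma] at hwW ⊢
        exact ⟨mem_filter.2 ⟨hwW.1, j, hw⟩, hwW.2⟩
    have hc := card_le_card hs
    rw [card_image_of_injective _ Subtype.val_injective, card_disjSum, card_sigma,
      card_sigma] at hc
    simp only [card_range] at hc
    have hsup : ({e ∈ E | e.1 ∈ X} ∪ {e ∈ E | e.1 ∉ X ∧ e.2 ∈ Y}) ⊆ s.biUnion u := by
      intro e he
      simp only [mem_union, mem_filter] at he
      rw [mem_biUnion]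
      rcases he with ⟨he, hx⟩ | ⟨he, -, hy⟩
      · obtain ⟨-, j, hj⟩ := mem_filter.1 hx
        obtain ⟨w, hw, hwj⟩ := mem_image.1 hj
        exact ⟨w, hw, by simp [u, hwj, he]⟩
      · obtain ⟨-, j, hj⟩ := mem_filter.1 hy
        obtain ⟨w, hw, hwj⟩ := mem_image.1 hj
        exact ⟨w, hw, by simp [u, hwj, he]⟩
    have hc' := card_le_card hsup
    rw [card_union_of_disjoint (by
      rw [disjoint_filter]; intro e _ h h'; exact h'.1 h)] at hc'
    have := h2 X (filter_subset _ _) Y (filter_subset _ _)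
    have := hsum X
    have := hsub X (filter_subset _ _)
    omega)
  have huE : ∀ w, g w ∈ E := by
    intro w
    have := hgu w
    rcases w with ⟨⟨a, j⟩ | ⟨b, j⟩, hw⟩ <;> simp only [u, Sum.elim_inl, Sum.elim_inr] at this <;>
      exact (mem_filter.1 this).1
  obtain ⟨f', hf', hf't, hWf⟩ : ∃ f' : E → (Σ _ : α, ℕ) ⊕ (Σ _ : β, ℕ), Function.Injective f' ∧
      (∀ e, f' e ∈ t e) ∧ (W : Set _) ⊆ Set.range f' := by
    by_cases hEe : Nonempty E
    · obtain ⟨e0⟩ := hEe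
      refine exists_injective_covering (fun e w => w ∈ t e) f hf hft W
        (fun w => if h : w ∈ W then ⟨g ⟨w, h⟩, huE _⟩ else e0) ?_ ?_
      · intro w hw w' hw' h
        simp only [mem_coe] at hw hw'
        simp only [hw, hw', dif_pos, Subtype.mk.injEq] at h
        exact congrArg Subtype.val (hg h)
      · intro w hw
        simp only [mem_coe] at hw
        simp only [hw, dif_pos]
        have hh := hgu ⟨w, hw⟩
        rcases w with ⟨a, j⟩ | ⟨b, j⟩
        · simp only [u, Sum.elim_inl, mem_filter] at hh
          simp only [hW, inl_mem_disjSum, mem_sigma] at hw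
          simp only [t, inl_mem_disjSum, mem_sigma, mem_singleton]
          exact ⟨hh.2.symm, hw.2⟩
        · simp only [u, Sum.elim_inr, mem_filter] at hh
          simp only [hW, inr_mem_disjSum, mem_sigma, mem_range] at hw
          simp only [t, inr_mem_disjSum, mem_sigma, mem_singleton, mem_range]
          exact ⟨hh.2.symm, hw.2.trans_le (hlq b)⟩
    · refine ⟨f, hf, hft, ?_⟩
      intro w hw
      exact absurd ⟨_, huE ⟨w, hw⟩⟩ (fun h : ∃ e, e ∈ E => hEe ⟨⟨h.choose, h.choose_spec⟩⟩)
  have hleft : ∀ e a j, f' e = Sum.inl ⟨a, j⟩ → e.1.1 = a ∧ j < deg a - d := by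
    intro e a j h
    have := hf't e
    rw [h] at this
    simp only [t, inl_mem_disjSum, mem_sigma, mem_singleton, mem_range] at this
    exact ⟨this.1.symm, this.2⟩
  have hright : ∀ e b j, f' e = Sum.inr ⟨b, j⟩ → e.1.2 = b ∧ j < q b := by
    intro e b j h
    have := hf't e
    rw [h] at this
    simp only [t, inr_mem_disjSum, mem_sigma, mem_singleton, mem_range] at this
    exact ⟨this.1.symm, this.2⟩
  set H : Finset (α × β) := (E.attach.filter fun e => (f' e).isRight).image Subtype.val with hH
  have hmemH : ∀ e : E, e.1 ∈ H ↔ (f' e).isRight := by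
    intro e
    simp [hH]
  have hHE : H ⊆ E := by
    intro e he
    obtain ⟨e', _, rfl⟩ := mem_image.1 he
    exact e'.2
  refine ⟨H, hHE, ?_, ?_⟩
  · intro a ha
    have hnot : #{e ∈ E | e.1 = a ∧ e ∉ H} = deg a - d := by
      rw [← card_range (deg a - d)]
      symm
      have hex : ∀ j ∈ range (deg a - d), ∃ e : E, f' e = Sum.inl ⟨a, j⟩ := by
        intro j hj
        exact hWf (by simp only [hW, mem_coe, inl_mem_disjSum, mem_sigma]; exact ⟨ha, hj⟩)
      choose F hF using hex
      refine card_bij (fun j hj => (F j hj).1) ?_ ?_ ?_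
      · intro j hj
        refine mem_filter.2 ⟨(F j hj).2, (hleft _ _ _ (hF j hj)).1, ?_⟩
        rw [hmemH, hF j hj]
        simp
      · intro i hi j hj h
        have := hF i hi
        rw [Subtype.ext h, hF j hj] at this
        simpa using this.symm
      · intro e he
        obtain ⟨heE, hea, heH⟩ := mem_filter.1 he
        have hn := (hmemH ⟨e, heE⟩).not.1 heH
        rcases hfe : f' ⟨e, heE⟩ with ⟨a', j⟩ | p
        · obtain ⟨ha', hj⟩ := hleft _ _ _ hfe
          have haa : a = a' := hea.symm.trans ha'
          subst haa
          refine ⟨j, mem_range.2 hj, ?_⟩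
          have h := (hF j (mem_range.2 hj)).trans hfe.symm
          rw [hf' h]
        · rw [hfe] at hn
          simp at hn
    have := card_filter_add_card_filter_not (s := {e ∈ E | e.1 = a}) (fun e => e ∈ H)
    rw [filter_filter, filter_filter, hnot] at this
    have h3 : {e ∈ E | e.1 = a ∧ e ∈ H} = {e ∈ H | e.1 = a} := by
      ext e
      simp only [mem_filter]
      exact ⟨fun h => ⟨h.2.2, h.2.1⟩, fun h => ⟨hHE h.1, h.2, h.1⟩⟩
    rw [h3] at this
    change _ = deg a at this
    have := hd a ha
    omega
  · intro b hb
    constructor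
    · have hex : ∀ j, j < l b → ∃ e : E, f' e = Sum.inr ⟨b, j⟩ := by
        intro j hj
        exact hWf (by
          simp only [hW, mem_coe, inr_mem_disjSum, mem_sigma, mem_range]; exact ⟨hb, hj⟩)
      choose F hF using hex
      calc l b = #(univ : Finset (Fin (l b))) := by simp
        _ ≤ _ := by
          refine card_le_card_of_injOn (fun j => (F j j.2).1) ?_ ?_
          · intro j _
            refine mem_coe.2 (mem_filter.2 ⟨?_, (hright _ _ _ (hF j j.2)).1⟩)
            rw [hmemH, hF j j.2]
            simp
          · intro i _ j _ h
            have := hF i i.2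
            rw [Subtype.ext h, hF j j.2] at this
            simp only [Sum.inr.injEq, Sigma.mk.injEq, true_and, heq_eq_eq] at this
            exact Fin.ext this.symm
    · have hex : ∀ e ∈ {e ∈ H | e.2 = b}, ∃ h : e ∈ E, ∃ j < q b, f' ⟨e, h⟩ = Sum.inr ⟨b, j⟩ := by
        intro e he
        obtain ⟨heH, heb⟩ := mem_filter.1 he
        have hn := (hmemH ⟨e, hHE heH⟩).1 heH
        rcases hfe : f' ⟨e, hHE heH⟩ with p | ⟨b', j⟩
        · rw [hfe] at hn
          simp at hn
        · obtain ⟨hb', hj⟩ := hright _ _ _ hfe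
          have hbb : b = b' := heb.symm.trans hb'
          subst hbb
          exact ⟨hHE heH, j, hj, hfe⟩
      choose hE' F hFq hF using hex
      calc _ ≤ #(range (q b)) := by
            refine card_le_card_of_forall_subsingleton (fun e j => ∃ h, F e h = j) ?_ ?_
            · intro e he
              exact ⟨_, mem_range.2 (hFq e he), he, rfl⟩
            · rintro j _ e ⟨he, h, h'⟩ e' ⟨he', h1, h1'⟩
              have h2 := (hF e h).trans ((by rw [h', h1'] : _ = _).trans (hF e' h1).symm)
              exact congrArg Subtype.val (hf' h2)
        _ = q b := card_range _

open Finset in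
/-- A bipartite graph that is `s`-regular on one side and has degrees at most `s` on the other has
a matching covering the first side and all vertices of degree `s`. -/
theorem exists_matching_covering {α β : Type*} [DecidableEq α] [DecidableEq β] [Nonempty β]
    (A : Finset α) (B : Finset β) (E : Finset (α × β)) (hE : E ⊆ A ×ˢ B) (s : ℕ) (hs : 1 ≤ s)
    (hA : ∀ a ∈ A, #{e ∈ E | e.1 = a} = s) (hB : ∀ b ∈ B, #{e ∈ E | e.2 = b} ≤ s) :
    ∃ f : α → β, Set.InjOn f A ∧ (∀ a ∈ A, (a, f a) ∈ E) ∧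
      ∀ b ∈ B, #{e ∈ E | e.2 = b} = s → ∃ a ∈ A, f a = b := by
  have hX : ∀ X ⊆ A, #{e ∈ E | e.1 ∈ X} = #X * s := by
    intro X hX
    rw [← sum_card_fiberwise_eq_card_filter, sum_const_nat fun a ha => hA a (hX ha)]
  have hY : ∀ Y : Finset β, #{e ∈ E | e.2 ∈ Y} = ∑ b ∈ Y, #{e ∈ E | e.2 = b} := by
    intro Y
    rw [← sum_card_fiberwise_eq_card_filter]
  have hYs : ∀ Y ⊆ B, #{e ∈ E | e.2 ∈ Y} ≤ #Y * s := by
    intro Y hYB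
    rw [hY]
    exact sum_le_card_nsmul _ _ _ fun b hb => hB b (hYB hb)
  obtain ⟨H, hHE, hHA, hHB⟩ := exists_subgraph_degrees A B E hE 1 (fun _ => 1)
    (fun b => if #{e ∈ E | e.2 = b} = s then 1 else 0) (fun b => by split_ifs <;> simp) (by
      intro X hXA Y hYB
      have h1 := hX X hXA
      have h2 := hYs Y hYB
      have h3 : #{e ∈ E | e.1 ∈ X} ≤ #{e ∈ E | e.2 ∈ Y} + #{e ∈ E | e.1 ∈ X ∧ e.2 ∉ Y} := by
        refine (card_le_card ?_).trans (card_union_le _ _)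
        intro e he
        simp only [mem_union, mem_filter] at he ⊢
        tauto
      rw [sum_const, smul_eq_mul, mul_one, one_mul]
      by_contra hlt
      push Not at hlt
      have : (#Y + (#X - #Y)) * s = #X * s := by congr 1; omega
      rw [add_mul] at this
      have : (#X - #Y) * 1 ≤ (#X - #Y) * s := Nat.mul_le_mul_left _ hs
      omega) (by
      intro X hXA Y hYB
      set Y' : Finset β := {b ∈ Y | #{e ∈ E | e.2 = b} = s} with hY'
      rw [← card_filter, one_mul, ← hY']
      have h1 := hX X hXA
      have h2 : #{e ∈ E | e.2 ∈ Y'} = #Y' * s := by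
        rw [hY, sum_const_nat fun b hb => (mem_filter.1 hb).2]
      have h3 : #{e ∈ E | e.2 ∈ Y'} ≤ #{e ∈ E | e.1 ∈ X} + #{e ∈ E | e.1 ∉ X ∧ e.2 ∈ Y} := by
        refine (card_le_card ?_).trans (card_union_le _ _)
        intro e he
        simp only [mem_union, mem_filter] at he ⊢
        have := mem_filter.1 he.2
        tauto
      by_contra hlt
      push Not at hlt
      have : (#X + (#Y' - #X)) * s = #Y' * s := by congr 1; omega
      rw [add_mul] at this
      have : (#Y' - #X) * 1 ≤ (#Y' - #X) * s := Nat.mul_le_mul_left _ hs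
      omega)
  have hex : ∀ a, ∃ b, a ∈ A → {e ∈ H | e.1 = a} = {(a, b)} := by
    intro a
    by_cases ha : a ∈ A
    · obtain ⟨e, he⟩ := card_eq_one.1 (hHA a ha)
      have h : e ∈ {e ∈ H | e.1 = a} := by rw [he]; exact mem_singleton_self _
      refine ⟨e.2, fun _ => ?_⟩
      rw [he, ← (mem_filter.1 h).2]
    · exact ⟨Classical.arbitrary β, fun h => absurd h ha⟩
  choose f hf using hex
  have hfH : ∀ a ∈ A, (a, f a) ∈ H := by
    intro a ha
    have : (a, f a) ∈ {e ∈ H | e.1 = a} := by rw [hf a ha]; exact mem_singleton_self _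
    exact (mem_filter.1 this).1
  refine ⟨f, ?_, fun a ha => hHE (hfH a ha), ?_⟩
  · intro a ha a' ha' h
    have hb := (hHB (f a) (mem_product.1 (hE (hHE (hfH a ha)))).2).2
    exact congrArg Prod.fst (card_le_one.1 hb (a, f a) (mem_filter.2 ⟨hfH a ha, rfl⟩) (a', f a')
      (mem_filter.2 ⟨hfH a' ha', h.symm⟩))
  · intro b hb hbs
    have h1 := (hHB b hb).1
    rw [if_pos hbs] at h1
    obtain ⟨e, he⟩ := card_pos.1 h1
    obtain ⟨heH, heb⟩ := mem_filter.1 he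
    have heA := (mem_product.1 (hE (hHE heH))).1
    have : e ∈ {x ∈ H | x.1 = e.1} := mem_filter.2 ⟨heH, rfl⟩
    rw [hf _ heA, mem_singleton] at this
    exact ⟨e.1, heA, by rw [← heb, this]⟩

open Finset in
/-- Two disjoint matchings covering one side of a bipartite graph, with prescribed bounds for the
number of their edges at each vertex of the other side. -/
theorem exists_two_matchings {α β : Type*} [DecidableEq α] [DecidableEq β] [Nonempty β]
    (A : Finset α) (B : Finset β) (E : Finset (α × β)) (hE : E ⊆ A ×ˢ B) (q l : β → ℕ)
    (hlq : ∀ b, l b ≤ q b) (hq : ∀ b, q b ≤ 2)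
    (h1 : ∀ X ⊆ A, ∀ Y ⊆ B, 2 * #X ≤ ∑ b ∈ Y, q b + #{e ∈ E | e.1 ∈ X ∧ e.2 ∉ Y})
    (h2 : ∀ X ⊆ A, ∀ Y ⊆ B, ∑ b ∈ Y, l b ≤ 2 * #X + #{e ∈ E | e.1 ∉ X ∧ e.2 ∈ Y}) :
    ∃ f g : α → β, Set.InjOn f A ∧ Set.InjOn g A ∧
      (∀ a ∈ A, f a ≠ g a ∧ (a, f a) ∈ E ∧ (a, g a) ∈ E) ∧
      ∀ b ∈ B, l b ≤ #{a ∈ A | f a = b} + #{a ∈ A | g a = b} ∧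
        #{a ∈ A | f a = b} + #{a ∈ A | g a = b} ≤ q b := by
  obtain ⟨H, hHE, hHA, hHB⟩ := exists_subgraph_degrees A B E hE 2 q l hlq h1 h2
  obtain ⟨f, hf, hfH, hfB⟩ := exists_matching_covering A B H (hHE.trans hE) 2 (by norm_num) hHA
    (fun b hb => (hHB b hb).2.trans (hq b))
  have hex : ∀ a, ∃ b, a ∈ A → b ≠ f a ∧ {e ∈ H | e.1 = a} = {(a, f a), (a, b)} := by
    intro a
    by_cases ha : a ∈ A
    · have hc := hHA a ha
      have hm : (a, f a) ∈ {e ∈ H | e.1 = a} := mem_filter.2 ⟨hfH a ha, rfl⟩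
      rw [← card_erase_add_one hm] at hc
      obtain ⟨e, he⟩ := card_eq_one.1 (Nat.succ_injective hc)
      have hme : e ∈ erase {e ∈ H | e.1 = a} (a, f a) := by rw [he]; exact mem_singleton_self _
      have hea : e.1 = a := (mem_filter.1 (mem_of_mem_erase hme)).2
      refine ⟨e.2, fun _ => ⟨fun h => ne_of_mem_erase hme (Prod.ext hea h), ?_⟩⟩
      rw [← insert_erase hm, he, ← hea]
    · exact ⟨Classical.arbitrary β, fun h => absurd h ha⟩
  choose g hg using hex
  have hgH : ∀ a ∈ A, (a, g a) ∈ H := by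
    intro a ha
    have : (a, g a) ∈ {e ∈ H | e.1 = a} := by rw [(hg a ha).2]; simp
    exact (mem_filter.1 this).1
  have hcount : ∀ b, #{e ∈ H | e.2 = b} = #{a ∈ A | f a = b} + #{a ∈ A | g a = b} := by
    intro b
    have : {e ∈ H | e.2 = b} = {a ∈ A | f a = b}.image (fun a => (a, f a)) ∪
        {a ∈ A | g a = b}.image (fun a => (a, g a)) := by
      ext ⟨a, b'⟩
      simp only [mem_filter, mem_union, mem_image, Prod.mk.injEq]
      constructor
      · rintro ⟨h, rfl⟩
        have ha := (mem_product.1 (hE (hHE h))).1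
        have : (a, b') ∈ {e ∈ H | e.1 = a} := mem_filter.2 ⟨h, rfl⟩
        rw [(hg a ha).2] at this
        simp only [mem_insert, mem_singleton, Prod.mk.injEq, true_and] at this
        rcases this with h | h
        · exact Or.inl ⟨a, ⟨ha, h.symm⟩, rfl, h.symm⟩
        · exact Or.inr ⟨a, ⟨ha, h.symm⟩, rfl, h.symm⟩
      · rintro (⟨a', ⟨ha', h⟩, rfl, rfl⟩ | ⟨a', ⟨ha', h⟩, rfl, rfl⟩)
        · exact ⟨hfH _ ha', h⟩
        · exact ⟨hgH _ ha', h⟩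
    rw [this, card_union_of_disjoint, card_image_of_injective, card_image_of_injective]
    · exact fun a a' h => congrArg Prod.fst h
    · exact fun a a' h => congrArg Prod.fst h
    · rw [Finset.disjoint_left]
      intro e he he'
      obtain ⟨a, ha, rfl⟩ := mem_image.1 he
      obtain ⟨a', ha', h⟩ := mem_image.1 he'
      obtain ⟨rfl, h⟩ := Prod.mk.inj h
      exact (hg _ (mem_filter.1 ha).1).1 h
  refine ⟨f, g, hf, ?_, fun a ha => ⟨(hg a ha).1.symm, hHE (hfH a ha), hHE (hgH a ha)⟩, ?_⟩
  · intro a ha a' ha' h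
    have hb := (mem_product.1 (hE (hHE (hgH a ha)))).2
    have h2 : #{e ∈ H | e.2 = g a} ≤ 2 := (hHB _ hb).2.trans (hq _)
    by_contra hne
    have hsub : ({(a, g a), (a', g a')} : Finset (α × β)) ⊆ {e ∈ H | e.2 = g a} := by
      intro e he
      rcases mem_insert.1 he with rfl | he
      · exact mem_filter.2 ⟨hgH a ha, rfl⟩
      · rw [mem_singleton.1 he]
        exact mem_filter.2 ⟨hgH a' ha', h.symm⟩
    have hc := card_le_card hsub
    rw [card_pair (fun h => hne (congrArg Prod.fst h))] at hc
    obtain ⟨a'', ha'', hfa⟩ := hfB _ hb (le_antisymm h2 hc)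
    have heq := eq_of_subset_of_card_le hsub (by rw [card_pair (fun h => hne (congrArg Prod.fst h))]; exact h2)
    have hmem : (a'', f a'') ∈ {e ∈ H | e.2 = g a} := mem_filter.2 ⟨hfH _ ha'', hfa⟩
    rw [← heq] at hmem
    simp only [mem_insert, mem_singleton, Prod.mk.injEq] at hmem
    rcases hmem with ⟨rfl, h'⟩ | ⟨rfl, h'⟩
    · exact (hg _ ha'').1 h'.symm
    · exact (hg _ ha'').1 h'.symm
  · intro b hb
    rw [← hcount]
    exact hHB b hb

open Finset in
/-- A finite set with a fixed-point-free involution has even cardinality. -/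
theorem even_card_of_involution {α : Type*} (A : Finset α) (σ : α → α)
    (h : ∀ a ∈ A, σ a ∈ A ∧ σ a ≠ a ∧ σ (σ a) = a) : Even #A := by
  rw [← ZMod.natCast_eq_zero_iff_even, cast_card]
  exact sum_involution (fun a _ => σ a) (fun _ _ => by decide) (fun a ha _ => (h a ha).2.1)
    (fun a ha => (h a ha).1) (fun a ha => (h a ha).2.2)

/-- `c` is a proper edge coloring, with colors in `K`, of the complete graph on `R`. -/
structure ProperOn {U : Type*} (R : Finset U) (K : Finset ℕ) (c : U → U → ℕ) : Prop where
  symm : ∀ x y, c x y = c y x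
  mem : ∀ x ∈ R, ∀ y ∈ R, x ≠ y → c x y ∈ K
  inj : ∀ x ∈ R, ∀ y ∈ R, ∀ z ∈ R, y ≠ x → z ≠ x → c x y = c x z → y = z

/-- The vertices of `R` at which no edge inside `R` has color `i`. -/
def missing {U : Type*} [DecidableEq U] (R : Finset U) (c : U → U → ℕ) (i : ℕ) : Finset U :=
  R.filter fun x => ∀ y ∈ R, y ≠ x → c x y ≠ i

theorem mem_missing {U : Type*} [DecidableEq U] {R : Finset U} {c : U → U → ℕ} {i : ℕ} {x : U} :
    x ∈ missing R c i ↔ x ∈ R ∧ ∀ y ∈ R, y ≠ x → c x y ≠ i := by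
  simp [missing]

theorem missing_subset {U : Type*} [DecidableEq U] (R : Finset U) (c : U → U → ℕ) (i : ℕ) :
    missing R c i ⊆ R := Finset.filter_subset _ _

/-- The bipartite graph joining each vertex of `R` to the colors in `K` missing at it. -/
def missingGraph {U : Type*} [DecidableEq U] (R : Finset U) (K : Finset ℕ) (c : U → U → ℕ) :
    Finset (U × ℕ) :=
  (R ×ˢ K).filter fun e => e.1 ∈ missing R c e.2

theorem mem_missingGraph {U : Type*} [DecidableEq U] {R : Finset U} {K : Finset ℕ}
    {c : U → U → ℕ} {x : U} {i : ℕ} :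
    (x, i) ∈ missingGraph R K c ↔ i ∈ K ∧ x ∈ missing R c i := by
  simp only [missingGraph, Finset.mem_filter, Finset.mem_product, mem_missing]
  tauto

open Finset in
theorem card_missingGraph_right {U : Type*} [DecidableEq U] {R : Finset U} {K : Finset ℕ}
    {c : U → U → ℕ} {i : ℕ} (hi : i ∈ K) :
    #{e ∈ missingGraph R K c | e.2 = i} = #(missing R c i) := by
  have : {e ∈ missingGraph R K c | e.2 = i} = (missing R c i).image fun x => (x, i) := by
    ext ⟨x, j⟩
    simp only [mem_filter, mem_missingGraph, mem_image, Prod.mk.injEq]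
    constructor
    · rintro ⟨⟨_, h⟩, rfl⟩
      exact ⟨x, h, rfl, rfl⟩
    · rintro ⟨_, h, rfl, rfl⟩
      exact ⟨⟨hi, h⟩, rfl⟩
  rw [this, card_image_of_injective]
  exact fun _ _ h => congrArg Prod.fst h

open Finset in
theorem ProperOn.card_missingGraph_left {U : Type*} [DecidableEq U] {R : Finset U} {K : Finset ℕ}
    {c : U → U → ℕ} (hc : ProperOn R K c) {x : U} (hx : x ∈ R) :
    #{e ∈ missingGraph R K c | e.1 = x} + #R = #K + 1 := by
  have h1 : {e ∈ missingGraph R K c | e.1 = x} =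
      (K \ (R.erase x).image (c x)).image fun i => (x, i) := by
    ext ⟨y, j⟩
    simp only [mem_filter, mem_missingGraph, mem_missing, mem_image, Prod.mk.injEq, mem_sdiff,
      mem_erase, not_exists, not_and]
    constructor
    · rintro ⟨⟨h, _, h'⟩, rfl⟩
      exact ⟨j, ⟨h, fun z hz => h' z hz.2 hz.1⟩, rfl, rfl⟩
    · rintro ⟨_, h, rfl, rfl⟩
      exact ⟨⟨h.1, hx, fun z hz hzx => h.2 z ⟨hzx, hz⟩⟩, rfl⟩
  have h2 : (R.erase x).image (c x) ⊆ K := by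
    intro i hi
    obtain ⟨y, hy, rfl⟩ := mem_image.1 hi
    exact hc.mem x hx y (mem_of_mem_erase hy) (ne_of_mem_erase hy).symm
  have h3 : #((R.erase x).image (c x)) + 1 = #R := by
    rw [card_image_of_injOn, card_erase_add_one hx]
    intro y hy z hz h
    rw [mem_coe, mem_erase] at hy hz
    exact hc.inj x hx y hy.2 z hz.2 hy.1 hz.1 h
  have h4 := card_sdiff_add_card_eq_card h2
  rw [h1, card_image_of_injective _ (fun _ _ h => congrArg Prod.snd h)]
  omega

open Finset in
theorem ProperOn.even_card_missing_add {U : Type*} [DecidableEq U] {R : Finset U} {K : Finset ℕ}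
    {c : U → U → ℕ} (hc : ProperOn R K c) (i : ℕ) : Even (#(missing R c i) + #R) := by
  have hex : ∀ x, ∃ y, x ∈ R \ missing R c i → y ∈ R ∧ y ≠ x ∧ c x y = i := by
    intro x
    by_cases hx : x ∈ R \ missing R c i
    · have := (mem_sdiff.1 hx).2
      rw [mem_missing] at this
      push Not at this
      obtain ⟨y, hy⟩ := this (mem_sdiff.1 hx).1
      exact ⟨y, fun _ => hy⟩
    · exact ⟨x, fun h => absurd h hx⟩
  choose σ hσ using hex
  have h := even_card_of_involution (R \ missing R c i) σ (by
    intro x hx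
    obtain ⟨h1, h2, h3⟩ := hσ x hx
    have hxR := (mem_sdiff.1 hx).1
    have hm : σ x ∈ R \ missing R c i := by
      rw [mem_sdiff, mem_missing]
      refine ⟨h1, fun h => h.2 x hxR h2.symm ?_⟩
      rw [hc.symm, h3]
    obtain ⟨h4, h5, h6⟩ := hσ _ hm
    exact ⟨hm, h2, hc.inj _ h1 _ h4 _ hxR h5 h2.symm (by rw [h6, hc.symm, h3])⟩)
  have := card_sdiff_add_card_eq_card (missing_subset R c i)
  rw [Nat.even_iff] at h ⊢
  omega

/-- The coloring obtained from `c` by coloring the edge between `v` and `x` with `f x`. -/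
def insertVertex {U : Type*} [DecidableEq U] (c : U → U → ℕ) (v : U) (f : U → ℕ) : U → U → ℕ :=
  fun x y => if x = v then f y else if y = v then f x else c x y

theorem insertVertex_left {U : Type*} [DecidableEq U] (c : U → U → ℕ) (v : U) (f : U → ℕ) (y : U) :
    insertVertex c v f v y = f y := by
  simp [insertVertex]

theorem insertVertex_right {U : Type*} [DecidableEq U] (c : U → U → ℕ) (v : U) (f : U → ℕ)
    (x : U) : insertVertex c v f x v = f x := by
  by_cases h : x = v <;> simp [insertVertex, h]

theorem insertVertex_of_ne {U : Type*} [DecidableEq U] (c : U → U → ℕ) (v : U) (f : U → ℕ)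
    {x y : U} (hx : x ≠ v) (hy : y ≠ v) : insertVertex c v f x y = c x y := by
  simp [insertVertex, hx, hy]

theorem ProperOn.insert {U : Type*} [DecidableEq U] {R : Finset U} {K : Finset ℕ}
    {c : U → U → ℕ} (hc : ProperOn R K c) {v : U} (hv : v ∉ R) {f : U → ℕ} (hf : Set.InjOn f R)
    (hfm : ∀ x ∈ R, f x ∈ K ∧ x ∈ missing R c (f x)) :
    ProperOn (insert v R) K (insertVertex c v f) where
  symm x y := by
    by_cases hx : x = v <;> by_cases hy : y = v <;> simp [insertVertex, hx, hy, hc.symm x y]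
  mem x hx y hy hxy := by
    rcases Finset.mem_insert.1 hx with rfl | hx'
    · rw [insertVertex_left]
      exact (hfm y (Finset.mem_of_mem_insert_of_ne hy hxy.symm)).1
    rcases Finset.mem_insert.1 hy with rfl | hy'
    · rw [insertVertex_right]
      exact (hfm x hx').1
    · rw [insertVertex_of_ne _ _ _ (ne_of_mem_of_not_mem hx' hv) (ne_of_mem_of_not_mem hy' hv)]
      exact hc.mem x hx' y hy' hxy
  inj x hx y hy z hz hyx hzx h := by
    rcases Finset.mem_insert.1 hx with rfl | hx'
    · rw [insertVertex_left, insertVertex_left] at h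
      exact hf (Finset.mem_of_mem_insert_of_ne hy hyx) (Finset.mem_of_mem_insert_of_ne hz hzx) h
    have hxv := ne_of_mem_of_not_mem hx' hv
    rcases Finset.mem_insert.1 hy with rfl | hy' <;> rcases Finset.mem_insert.1 hz with rfl | hz'
    · rfl
    · rw [insertVertex_right, insertVertex_of_ne _ _ _ hxv (ne_of_mem_of_not_mem hz' hv)] at h
      exact absurd h.symm ((mem_missing.1 (hfm x hx').2).2 z hz' hzx)
    · rw [insertVertex_right, insertVertex_of_ne _ _ _ hxv (ne_of_mem_of_not_mem hy' hv)] at h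
      exact absurd h ((mem_missing.1 (hfm x hx').2).2 y hy' hyx)
    · rw [insertVertex_of_ne _ _ _ hxv (ne_of_mem_of_not_mem hy' hv),
        insertVertex_of_ne _ _ _ hxv (ne_of_mem_of_not_mem hz' hv)] at h
      exact hc.inj x hx' y hy' z hz' hyx hzx h

theorem mem_missing_insertVertex {U : Type*} [DecidableEq U] {R : Finset U} {c : U → U → ℕ}
    {v : U} (hv : v ∉ R) {f : U → ℕ} {i : ℕ} {x : U} (hx : x ∈ R) :
    x ∈ missing (insert v R) (insertVertex c v f) i ↔ x ∈ missing R c i ∧ f x ≠ i := by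
  have hxv := ne_of_mem_of_not_mem hx hv
  rw [mem_missing, mem_missing, Finset.forall_mem_insert, insertVertex_right]
  simp only [Finset.mem_insert, hx, or_true, true_and]
  constructor
  · rintro ⟨h1, h2⟩
    refine ⟨fun y hy hyx => ?_, h1 hxv.symm⟩
    have := h2 y hy hyx
    rwa [insertVertex_of_ne _ _ _ hxv (ne_of_mem_of_not_mem hy hv)] at this
  · rintro ⟨h1, h2⟩
    refine ⟨fun _ => h2, fun y hy hyx => ?_⟩
    rw [insertVertex_of_ne _ _ _ hxv (ne_of_mem_of_not_mem hy hv)]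
    exact h1 y hy hyx

theorem self_mem_missing_insertVertex {U : Type*} [DecidableEq U] {R : Finset U} {c : U → U → ℕ}
    {v : U} (hv : v ∉ R) {f : U → ℕ} {i : ℕ} :
    v ∈ missing (insert v R) (insertVertex c v f) i ↔ ∀ x ∈ R, f x ≠ i := by
  simp only [mem_missing, insertVertex_left, Finset.mem_insert, true_or, true_and]
  refine ⟨fun h x hx => h x (Or.inr hx) (ne_of_mem_of_not_mem hx hv), ?_⟩
  rintro h x (rfl | hx) hxv
  · exact absurd rfl hxv
  · exact h x hx

open Finset in
theorem card_missing_insertVertex {U : Type*} [DecidableEq U] {R : Finset U} {c : U → U → ℕ}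
    {v : U} (hv : v ∉ R) {f : U → ℕ} (hf : Set.InjOn f R)
    (hfm : ∀ x ∈ R, x ∈ missing R c (f x)) (i : ℕ) :
    #(missing (insert v R) (insertVertex c v f) i) + 2 * #{x ∈ R | f x = i} =
      #(missing R c i) + 1 := by
  have hsub : ∀ w ∈ missing (insert v R) (insertVertex c v f) i, w = v ∨ w ∈ R := fun w hw =>
    mem_insert.1 (missing_subset _ _ _ hw)
  by_cases h : ∃ x ∈ R, f x = i
  · obtain ⟨x, hx, rfl⟩ := h
    have h1 : {y ∈ R | f y = f x} = {x} := by
      ext y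
      simp only [mem_filter, mem_singleton]
      exact ⟨fun h => hf h.1 hx h.2, by rintro rfl; exact ⟨hx, rfl⟩⟩
    have h2 : missing (insert v R) (insertVertex c v f) (f x) = (missing R c (f x)).erase x := by
      ext w
      rw [mem_erase]
      constructor
      · intro hw
        rcases hsub w hw with rfl | hwR
        · exact absurd rfl ((self_mem_missing_insertVertex hv).1 hw x hx)
        · rw [mem_missing_insertVertex hv hwR] at hw
          exact ⟨fun h => hw.2 (h ▸ rfl), hw.1⟩
      · rintro ⟨hwx, hw⟩
        have hwR := missing_subset _ _ _ hw
        rw [mem_missing_insertVertex hv hwR]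
        exact ⟨hw, fun h => hwx (hf hwR hx h)⟩
    rw [h1, h2, card_singleton, mul_one, ← card_erase_add_one (hfm x hx)]
  · push Not at h
    have h2 : missing (insert v R) (insertVertex c v f) i = insert v (missing R c i) := by
      ext w
      rw [mem_insert]
      constructor
      · intro hw
        rcases hsub w hw with rfl | hwR
        · exact Or.inl rfl
        · rw [mem_missing_insertVertex hv hwR] at hw
          exact Or.inr hw.1
      · rintro (rfl | hw)
        · rw [self_mem_missing_insertVertex hv]
          exact h
        · have hwR := missing_subset _ _ _ hw
          rw [mem_missing_insertVertex hv hwR]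
          exact ⟨hw, h w hwR⟩
    rw [h2, card_insert_of_notMem (fun h => hv (missing_subset _ _ _ h)),
      filter_eq_empty_iff.2 fun x hx => h x hx]
    simp

open Finset in
/-- A coloring of the complete graph on `R` in which every color misses few vertices extends to
the complete graph on `W`. -/
theorem exists_extension {U : Type*} [DecidableEq U] {W : Finset U} {K : Finset ℕ}
    (hWK : #W = #K + 1) (hW : Even #W) (s : ℕ) (R : Finset U) (hR : R ⊆ W) (c : U → U → ℕ)
    (hs : #R + s = #W) (hc : ProperOn R K c) (hd : ∀ i ∈ K, #(missing R c i) ≤ s) :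
    ∃ c', ProperOn W K c' ∧ ∀ x ∈ R, ∀ y ∈ R, c' x y = c x y := by
  induction s generalizing R c with
  | zero => exact ⟨c, eq_of_subset_of_card_le hR hs.ge ▸ hc, fun _ _ _ _ => rfl⟩
  | succ s ih =>
    obtain ⟨v, hvW, hvR⟩ := exists_of_ssubset (hR.ssubset_of_ne (by rintro rfl; omega))
    obtain ⟨f, hf, hfE, hfK⟩ := exists_matching_covering R K (missingGraph R K c)
      (filter_subset _ _) (s + 1) (by omega)
      (fun x hx => by have := hc.card_missingGraph_left hx; omega)
      (fun i hi => by rw [card_missingGraph_right hi]; exact hd i hi)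
    have hfm : ∀ x ∈ R, f x ∈ K ∧ x ∈ missing R c (f x) := fun x hx => mem_missingGraph.1 (hfE x hx)
    obtain ⟨c', hc', hcc'⟩ := ih (insert v R) (insert_subset hvW hR) (insertVertex c v f)
      (by rw [card_insert_of_notMem hvR]; omega) (hc.insert hvR hf hfm) (by
        intro i hi
        have h1 := card_missing_insertVertex hvR hf (fun x hx => (hfm x hx).2) i
        have h2 := hd i hi
        have h3 := hc.even_card_missing_add i
        rw [← hs] at hW
        rw [Nat.even_iff] at h3 hW
        by_cases h4 : #(missing R c i) = s + 1
        · obtain ⟨x, hx, hxi⟩ := hfK i hi (by rw [card_missingGraph_right hi]; exact h4)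
          have : 0 < #{x ∈ R | f x = i} := card_pos.2 ⟨x, mem_filter.2 ⟨hx, hxi⟩⟩
          omega
        · omega)
    refine ⟨c', hc', fun x hx y hy => ?_⟩
    rw [hcc' x (mem_insert_of_mem hx) y (mem_insert_of_mem hy),
      insertVertex_of_ne _ _ _ (ne_of_mem_of_not_mem hx hvR) (ne_of_mem_of_not_mem hy hvR)]

open Finset in
/-- The matchings used to add the two ends `v`, `w` of a prescribed edge of color `c₀`. -/
theorem ProperOn.exists_two_matchings {U : Type*} [DecidableEq U] {R : Finset U} {K : Finset ℕ}
    {c : U → U → ℕ} (hc : ProperOn R K c) {s : ℕ} (hs : #R + s = #K + 1) (t : ℕ → ℕ) {c₀ : ℕ}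
    (hc₀ : c₀ ∈ K) (ht : 2 ≤ t c₀) (htK : ∑ i ∈ K, t i + 2 ≤ s)
    (hd : ∀ i ∈ K, #(missing R c i) + t i ≤ s) :
    ∃ f g : U → ℕ, Set.InjOn f R ∧ Set.InjOn g R ∧
      (∀ x ∈ R, f x ≠ g x ∧ (f x ∈ K ∧ x ∈ missing R c (f x)) ∧
        (g x ∈ K ∧ x ∈ missing R c (g x))) ∧
      (∀ x ∈ R, f x ≠ c₀ ∧ g x ≠ c₀) ∧
      ∀ i ∈ K, i ≠ c₀ → (#(missing R c i) + t i = s →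
          2 ≤ #{x ∈ R | f x = i} + #{x ∈ R | g x = i}) ∧
        (#(missing R c i) + t i + 2 = s → 1 ≤ #{x ∈ R | f x = i} + #{x ∈ R | g x = i}) := by
  set E := missingGraph R K c with hE
  have hX : ∀ X ⊆ R, #{e ∈ E | e.1 ∈ X} = #X * s := by
    intro X hX
    rw [← sum_card_fiberwise_eq_card_filter, sum_const_nat fun x hx => ?_]
    have := hc.card_missingGraph_left (hX hx)
    rw [hE]
    omega
  have hY : ∀ Y ⊆ K, #{e ∈ E | e.2 ∈ Y} = ∑ i ∈ Y, #(missing R c i) := by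
    intro Y hY
    rw [← sum_card_fiberwise_eq_card_filter]
    exact sum_congr rfl fun i hi => card_missingGraph_right (hY hi)
  obtain ⟨f, g, hf, hg, hfg, hcount⟩ := _root_.exists_two_matchings R K E (filter_subset _ _)
    (fun i => if i = c₀ then 0 else 2)
    (fun i => if i = c₀ then 0 else if #(missing R c i) + t i = s then 2
      else if #(missing R c i) + t i + 2 = s then 1 else 0)
    (fun i => by split_ifs <;> simp) (fun i => by split_ifs <;> simp) (by
      intro X hXR Y hYK
      have h1 := hX X hXR
      have h2 := hY Y hYK
      have h3 : #{e ∈ E | e.1 ∈ X} ≤ #{e ∈ E | e.2 ∈ Y} + #{e ∈ E | e.1 ∈ X ∧ e.2 ∉ Y} := by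
        refine (card_le_card ?_).trans (card_union_le _ _)
        intro e he
        simp only [mem_union, mem_filter] at he ⊢
        tauto
      have h4 : ∑ i ∈ Y, #(missing R c i) ≤ #(Y.erase c₀) * s + (s - 2) := by
        have h5 : ∑ i ∈ Y.erase c₀, #(missing R c i) ≤ #(Y.erase c₀) * s :=
          sum_le_card_nsmul _ _ _ fun i hi =>
            (Nat.le_add_right _ _).trans (hd i (hYK (mem_of_mem_erase hi)))
        by_cases h : c₀ ∈ Y
        · rw [← sum_erase_add _ _ h]
          have := hd c₀ hc₀
          omega
        · rw [erase_eq_of_notMem h] at h5 ⊢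
          omega
      have h6 : ∑ i ∈ Y, (if i = c₀ then 0 else 2) = #(Y.erase c₀) * 2 := by
        rw [← sum_const_nat (s := Y.erase c₀) (m := 2) (f := fun _ => 2) (fun _ _ => rfl),
          ← filter_ne', sum_filter]
        exact sum_congr rfl fun i _ => by split_ifs <;> simp_all
      rw [h6]
      set e := #{e ∈ E | e.1 ∈ X ∧ e.2 ∉ Y}
      set y := #(Y.erase c₀)
      by_contra hlt
      push Not at hlt
      have h7 : #X * s ≤ y * s + (s - 2) + e := by omega
      have h8 : 2 ≤ s := by omega
      obtain ⟨u, rfl⟩ := Nat.exists_eq_add_of_le h8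
      obtain ⟨D, hD⟩ := Nat.exists_eq_add_of_le (show y + 1 ≤ #X by omega)
      rw [hD] at h7 hlt
      have : (y + 1 + D) * (2 + u) = y * (2 + u) + 2 + u + 2 * D + u * D := by ring
      have : 0 ≤ u * D := Nat.zero_le _
      omega) (by
      intro X hXR Y hYK
      have h1 := hX X hXR
      set Y' := Y.erase c₀ with hY'
      have hY'K : Y' ⊆ K := (erase_subset _ _).trans hYK
      set Y₂ := {i ∈ Y' | #(missing R c i) + t i = s} with hY₂
      set Y₁ := {i ∈ Y' | #(missing R c i) + t i + 2 = s} with hY₁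
      have hdis : Disjoint Y₂ Y₁ := by
        rw [Finset.disjoint_left]
        intro i hi hi'
        have := (mem_filter.1 hi).2
        have := (mem_filter.1 hi').2
        omega
      have hsub : Y₂ ∪ Y₁ ⊆ Y' := union_subset (filter_subset _ _) (filter_subset _ _)
      have h2 := hY _ (hsub.trans hY'K)
      have h3 : #{e ∈ E | e.2 ∈ Y₂ ∪ Y₁} ≤
          #{e ∈ E | e.1 ∈ X} + #{e ∈ E | e.1 ∉ X ∧ e.2 ∈ Y} := by
        refine (card_le_card ?_).trans (card_union_le _ _)
        intro e he
        simp only [mem_union (s := filter _ _), mem_filter (s := E)] at he ⊢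
        have := mem_of_mem_erase (hsub he.2)
        tauto
      have h4 : ∑ i ∈ Y₂ ∪ Y₁, t i + 4 ≤ s := by
        have h5 : ∑ i ∈ Y₂ ∪ Y₁, t i ≤ ∑ i ∈ K.erase c₀, t i :=
          sum_le_sum_of_subset (hsub.trans (erase_subset_erase _ hYK))
        have := sum_erase_add _ t hc₀
        omega
      have h5 : ∑ i ∈ Y₂ ∪ Y₁, #(missing R c i) + ∑ i ∈ Y₂ ∪ Y₁, t i =
          #Y₂ * s + #Y₁ * (s - 2) := by
        rw [← sum_add_distrib, sum_union hdis,
          sum_const_nat (s := Y₂) (m := s) fun i hi => (mem_filter.1 hi).2,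
          sum_const_nat (s := Y₁) (m := s - 2) fun i hi => ?_]
        have := (mem_filter.1 hi).2
        omega
      have h6 : ∑ i ∈ Y, (if i = c₀ then 0 else if #(missing R c i) + t i = s then 2
          else if #(missing R c i) + t i + 2 = s then 1 else 0) = 2 * #Y₂ + #Y₁ := by
        rw [hY₂, hY₁, card_filter, card_filter, mul_sum, ← sum_add_distrib, hY', ← filter_ne',
          sum_filter]
        refine sum_congr rfl fun i _ => ?_
        split_ifs <;> omega
      rw [h6]
      set e := #{e ∈ E | e.1 ∉ X ∧ e.2 ∈ Y}
      by_contra hlt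
      push Not at hlt
      obtain ⟨u, rfl⟩ := Nat.exists_eq_add_of_le (show 4 ≤ s by omega)
      have h7 : #Y₂ * (4 + u) + #Y₁ * (2 + u) ≤ u + #X * (4 + u) + e := by
        have : 4 + u - 2 = 2 + u := by omega
        rw [this] at h5
        omega
      obtain ⟨D, hD⟩ := Nat.exists_eq_add_of_le (show #X + 1 ≤ #Y₂ + #Y₁ by omega)
      zify at hD hlt h7
      have : (0 : ℤ) ≤ u * D := by positivity
      have hx : (#X : ℤ) = #Y₂ + #Y₁ - 1 - D := by linarith
      rw [hx] at h7 hlt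
      nlinarith)
  refine ⟨f, g, hf, hg, fun x hx => ⟨(hfg x hx).1, mem_missingGraph.1 (hfg x hx).2.1,
    mem_missingGraph.1 (hfg x hx).2.2⟩, ?_, ?_⟩
  · intro x hx
    have h := (hcount c₀ hc₀).2
    rw [if_pos rfl] at h
    have h1 : #{x ∈ R | f x = c₀} = 0 := by omega
    have h2 : #{x ∈ R | g x = c₀} = 0 := by omega
    exact ⟨filter_eq_empty_iff.1 (card_eq_zero.1 h1) hx, filter_eq_empty_iff.1 (card_eq_zero.1 h2) hx⟩
  · intro i hi hne
    have h := (hcount i hi).1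
    rw [if_neg hne] at h
    split_ifs at h <;> omega

open Finset in
/-- A coloring of the complete graph on `R` extends to the complete graph on `W` in such a way that
the pairs `{x, σ x}` in `T` receive the prescribed colors `p x`, provided that every color misses
few vertices and `T` is small. -/
theorem exists_extension_of_pairs {U : Type*} [DecidableEq U] {W : Finset U} {K : Finset ℕ}
    (hWK : #W = #K + 1) (hW : Even #W) (σ : U → U) (p : U → ℕ) (m : ℕ) (T : Finset U)
    (hm : #T ≤ m) (hT : T ⊆ W)
    (hσ : ∀ x ∈ T, (σ x ∈ T ∧ σ x ≠ x ∧ σ (σ x) = x) ∧ p x ∈ K ∧ p (σ x) = p x)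
    (s : ℕ) (R : Finset U) (hR : R ⊆ W) (hRT : Disjoint R T) (c : U → U → ℕ)
    (hs : #R + s = #W) (hTs : #T + 2 ≤ s) (hc : ProperOn R K c)
    (hd : ∀ i ∈ K, #(missing R c i) + #{x ∈ T | p x = i} ≤ s) :
    ∃ c', ProperOn W K c' ∧ (∀ x ∈ R, ∀ y ∈ R, c' x y = c x y) ∧
      ∀ x ∈ T, c' x (σ x) = p x := by
  induction m generalizing T s R c with
  | zero =>
    obtain rfl : T = ∅ := card_eq_zero.1 (by omega)
    obtain ⟨c', h1, h2⟩ := exists_extension hWK hW s R hR c hs hc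
      (fun i hi => by simpa using hd i hi)
    exact ⟨c', h1, h2, by simp⟩
  | succ m ih =>
    obtain rfl | ⟨v, hvT⟩ := T.eq_empty_or_nonempty
    · exact ih ∅ (by simp) hT hσ s R hR hRT c hs hTs hc hd
    obtain ⟨⟨hwT, hwv, hwσ⟩, hvK, hpw⟩ := hσ v hvT
    have hvR : v ∉ R := disjoint_right.1 hRT hvT
    have hwR : σ v ∉ insert v R := by
      rw [mem_insert, not_or]
      exact ⟨hwv, disjoint_right.1 hRT hwT⟩
    set T' : Finset U := (T.erase v).erase (σ v) with hT'
    have hTT' : T' ⊆ T := (erase_subset _ _).trans (erase_subset _ _)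
    have hcT' : #T' + 2 = #T := by
      rw [← card_erase_add_one hvT, ← card_erase_add_one (mem_erase.2 ⟨hwv, hwT⟩)]
    have heven : ∀ i, Even #{x ∈ T | p x = i} := by
      intro i
      refine even_card_of_involution _ σ fun x hx => ?_
      obtain ⟨hx, hpx⟩ := mem_filter.1 hx
      obtain ⟨h1, -, h2⟩ := hσ x hx
      exact ⟨mem_filter.2 ⟨h1.1, h2.trans hpx⟩, h1.2⟩
    have htp : #{x ∈ T' | p x = p v} + 2 = #{x ∈ T | p x = p v} := by
      have h1 : {x ∈ T' | p x = p v} = (({x ∈ T | p x = p v}).erase v).erase (σ v) := by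
        ext x
        simp only [hT', mem_filter, mem_erase]
        tauto
      rw [h1, ← card_erase_add_one (s := {x ∈ T | p x = p v}) (mem_filter.2 ⟨hvT, rfl⟩),
        ← card_erase_add_one (a := σ v) (mem_erase.2 ⟨hwv, mem_filter.2 ⟨hwT, hpw⟩⟩)]
    obtain ⟨f, g, hf, hg, hfg, hne, hcount⟩ := hc.exists_two_matchings (s := s) (by omega)
      (fun i => #{x ∈ T | p x = i}) hvK (by omega) (by
        rw [sum_card_fiberwise_eq_card_filter]
        have := card_filter_le T (fun x => p x ∈ K)
        omega) hd
    have hgv : ∀ x ∈ R, Function.update g v (p v) x = g x := fun x hx =>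
      Function.update_of_ne (ne_of_mem_of_not_mem hx hvR) _ _
    set c₁ := insertVertex c v f with hc₁
    have hc₁p : ProperOn (insert v R) K c₁ := hc.insert hvR hf fun x hx => (hfg x hx).2.1
    set g' := Function.update g v (p v) with hg'
    have hg'v : g' v = p v := Function.update_self _ _ _
    have hg'i : Set.InjOn g' (insert v R : Finset U) := by
      intro x hx y hy h
      rcases mem_insert.1 hx with hxv | hx' <;> rcases mem_insert.1 hy with hyv | hy'
      · rw [hxv, hyv]
      · rw [hgv y hy', hxv, hg'v] at h
        exact absurd h.symm (hne y hy').2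
      · rw [hgv x hx', hyv, hg'v] at h
        exact absurd h (hne x hx').2
      · rw [hgv x hx', hgv y hy'] at h
        exact hg hx' hy' h
    have hg'm : ∀ x ∈ insert v R, g' x ∈ K ∧ x ∈ missing (insert v R) c₁ (g' x) := by
      intro x hx
      rcases mem_insert.1 hx with rfl | hx
      · rw [hg'v, self_mem_missing_insertVertex hvR]
        exact ⟨hvK, fun y hy => (hne y hy).1⟩
      · rw [hgv x hx, mem_missing_insertVertex hvR hx]
        exact ⟨(hfg x hx).2.2.1, (hfg x hx).2.2.2, (hfg x hx).1⟩
    have hc₂p := hc₁p.insert hwR hg'i hg'm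
    set c₂ := insertVertex c₁ (σ v) g' with hc₂
    obtain ⟨c', hc', hcc', hcT⟩ := ih T' (by omega) (hTT'.trans hT) (by
        intro x hx
        obtain ⟨h1, h2⟩ := mem_erase.1 hx
        obtain ⟨h2, h3⟩ := mem_erase.1 h2
        obtain ⟨⟨h4, h5, h6⟩, h7⟩ := hσ x h3
        refine ⟨⟨mem_erase.2 ⟨fun h => h2 ?_, mem_erase.2 ⟨fun h => h1 ?_, h4⟩⟩, h5, h6⟩, h7⟩
        · rw [← h6, h, hwσ]
        · rw [← h, h6]) (s - 2) (insert (σ v) (insert v R))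
      (insert_subset (hT hwT) (insert_subset (hT hvT) hR)) (by
        rw [disjoint_insert_left, disjoint_insert_left]
        exact ⟨by simp [hT'], by simp [hT'], hRT.mono_right hTT'⟩) c₂
      (by rw [card_insert_of_notMem hwR, card_insert_of_notMem hvR]; omega) (by omega) hc₂p (by
        intro i hi
        have h1 := card_missing_insertVertex hvR hf (fun x hx => (hfg x hx).2.1.2) i
        have h2 := card_missing_insertVertex hwR hg'i (fun x hx => (hg'm x hx).2) i
        have h3 : #{x ∈ insert v R | g' x = i} = #{x ∈ R | g x = i} + if p v = i then 1 else 0 := by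
          have h4 : {x ∈ R | g' x = i} = {x ∈ R | g x = i} :=
            filter_congr fun x hx => by rw [hgv x hx]
          rw [filter_insert, hg'v, h4]
          split_ifs
          · rw [card_insert_of_notMem fun h => hvR (mem_filter.1 h).1]
          · rfl
        rw [← hc₁] at h1
        rw [← hc₂] at h2
        have h5 := hd i hi
        by_cases hip : p v = i
        · rw [if_pos hip] at h3
          rw [← hip] at h3 h1 h2 h5 ⊢
          omega
        · rw [if_neg hip] at h3
          have h6 := hcount i hi (Ne.symm hip)
          have h7 : #{x ∈ T' | p x = i} ≤ #{x ∈ T | p x = i} :=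
            card_le_card (filter_subset_filter _ hTT')
          have h8 := hc.even_card_missing_add i
          have h9 := heven i
          rw [← hs] at hW
          rw [Nat.even_iff] at h8 h9 hW
          omega)
    have hvw : c' v (σ v) = p v := by
      rw [hcc' v (by simp) (σ v) (by simp), hc₂, insertVertex_right, hg'v]
    refine ⟨c', hc', fun x hx y hy => ?_, fun x hx => ?_⟩
    · have hx' := mem_insert_of_mem (b := v) hx
      have hy' := mem_insert_of_mem (b := v) hy
      rw [hcc' x (mem_insert_of_mem hx') y (mem_insert_of_mem hy'), hc₂,
        insertVertex_of_ne _ _ _ (ne_of_mem_of_not_mem hx' hwR) (ne_of_mem_of_not_mem hy' hwR), hc₁,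
        insertVertex_of_ne _ _ _ (ne_of_mem_of_not_mem hx hvR) (ne_of_mem_of_not_mem hy hvR)]
    · by_cases hxv : x = v
      · rw [hxv, hvw]
      by_cases hxw : x = σ v
      · rw [hxw, hwσ, hc'.symm, hvw, hpw]
      · exact hcT x (mem_erase.2 ⟨hxw, mem_erase.2 ⟨hxv, hx⟩⟩)

open Finset in
/-- In a finite graph whose vertices `v` have degree at most `2 - a v - b v`, some union of
components has a positive excess of `a` over `b`, unless the whole graph has none. -/
theorem exists_component_excess {U : Type*} [Fintype U] (G : SimpleGraph U) [DecidableRel G.Adj]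
    (a b : U → ℕ) (h2 : ∀ v, G.degree v + a v + b v ≤ 2) (hab : ∑ v, b v < ∑ v, a v) :
    ∃ S : Finset U, (∀ x y, G.Adj x y → (x ∈ S ↔ y ∈ S)) ∧ ∑ v ∈ S, b v < ∑ v ∈ S, a v ∧
      ∑ v ∈ S, a v + ∑ v ∈ S, b v ≤ 2 := by
  classical
  have hfib : ∀ f : U → ℕ, ∑ v, f v =
      ∑ C : G.ConnectedComponent, ∑ v with G.connectedComponentMk v = C, f v :=
    fun f => (sum_fiberwise _ _ _).symm
  rw [hfib, hfib] at hab
  obtain ⟨C, -, hC⟩ := exists_lt_of_sum_lt hab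
  set S : Finset U := {v | G.connectedComponentMk v = C} with hS
  refine ⟨S, fun x y hxy => ?_, hC, ?_⟩
  · simp only [hS, mem_filter, mem_univ, true_and]
    rw [SimpleGraph.ConnectedComponent.connectedComponentMk_eq_of_adj hxy]
  · have h1 := (C.connected_toSimpleGraph).card_vert_le_card_edgeSet_add_one
    rw [Nat.card_eq_fintype_card, Nat.card_eq_fintype_card, ← SimpleGraph.edgeFinset_card] at h1
    have h3 := C.toSimpleGraph.sum_degrees_eq_twice_card_edges
    have hmem : ∀ v, v ∈ S ↔ v ∈ C.supp := fun v => by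
      simp [hS, SimpleGraph.ConnectedComponent.mem_supp_iff]
    have h4 : Fintype.card C = #S := by
      rw [← Nat.card_eq_fintype_card]
      exact Nat.subtype_card S hmem
    have h5 : ∑ v : C, C.toSimpleGraph.degree v ≤ ∑ v ∈ S, G.degree v := by
      rw [← sum_coe_sort S, ← sum_equiv (Equiv.subtypeEquivRight hmem).symm
        (s := univ) (t := univ) (f := fun v : C => G.degree v.1) (by simp) (fun _ _ => rfl)]
      refine sum_le_sum fun v _ => ?_
      rw [← SimpleGraph.card_neighborFinset_eq_degree, ← SimpleGraph.card_neighborFinset_eq_degree]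
      refine card_le_card_of_injOn (fun w => w.1) ?_ (fun _ _ _ _ h => Subtype.ext h)
      intro w hw
      rw [SimpleGraph.coe_neighborFinset, SimpleGraph.mem_neighborSet] at hw ⊢
      exact hw
    have h6 : ∑ v ∈ S, (G.degree v + a v + b v) ≤ #S * 2 :=
      sum_le_card_nsmul _ _ _ fun v _ => h2 v
    rw [sum_add_distrib, sum_add_distrib] at h6
    rw [h4] at h1
    omega

open Finset in
/-- Exchanging two colors along a union of Kempe chains makes their numbers of missing vertices
more equal. -/
theorem ProperOn.exists_kempe_change {U : Type*} [DecidableEq U] {R : Finset U} {K : Finset ℕ}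
    {c : U → U → ℕ} (hc : ProperOn R K c) {i g : ℕ} (hi : i ∈ K) (hg : g ∈ K)
    (hlt : #(missing R c i) < #(missing R c g)) :
    ∃ c', ProperOn R K c' ∧
      (∀ x ∈ R, ∀ y ∈ R, x ≠ y → c x y ≠ i → c x y ≠ g → c' x y = c x y) ∧
      (∀ j, j ≠ i → j ≠ g → missing R c' j = missing R c j) ∧
      #(missing R c' i) + #(missing R c' g) = #(missing R c i) + #(missing R c g) ∧
      #(missing R c' i) ≤ #(missing R c i) + 2 ∧ #(missing R c' g) < #(missing R c g) := by
  classical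
  have hig : i ≠ g := by rintro rfl; exact lt_irrefl _ hlt
  let G : SimpleGraph R :=
    { Adj := fun x y => x ≠ y ∧ (c x y = i ∨ c x y = g)
      symm := ⟨fun x y h => ⟨h.1.symm, by rw [hc.symm]; exact h.2⟩⟩
      loopless := ⟨fun x h => h.1 rfl⟩ }
  have hsum : ∀ (j : ℕ) (S : Finset R), ∑ v ∈ S, (if v.1 ∈ missing R c j then 1 else 0) =
      #(missing R c j ∩ S.map (Function.Embedding.subtype _)) := by
    intro j S
    rw [← card_filter, ← card_map (Function.Embedding.subtype _)]
    congr 1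
    ext x
    simp only [mem_map, mem_filter, mem_inter, Function.Embedding.coe_subtype]
    constructor
    · rintro ⟨y, ⟨h, h'⟩, rfl⟩
      exact ⟨h', y, h, rfl⟩
    · rintro ⟨h, y, h', rfl⟩
      exact ⟨y, ⟨h', h⟩, rfl⟩
  have huniv : ∀ j, missing R c j ∩ (univ : Finset R).map (Function.Embedding.subtype _) =
      missing R c j := by
    intro j
    rw [inter_eq_left]
    intro x hx
    exact mem_map.2 ⟨⟨x, missing_subset _ _ _ hx⟩, mem_univ _, rfl⟩
  obtain ⟨S₀, hS₀, hS1, hS2⟩ := exists_component_excess G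
    (fun v => if v.1 ∈ missing R c g then 1 else 0) (fun v => if v.1 ∈ missing R c i then 1 else 0)
    (by
      intro x
      have h1 : #((G.neighborFinset x).image fun y : R => c x y) = G.degree x := by
        rw [← SimpleGraph.card_neighborFinset_eq_degree]
        refine card_image_of_injOn fun y hy z hz h => ?_
        simp only [SimpleGraph.coe_neighborFinset, SimpleGraph.mem_neighborSet] at hy hz
        exact Subtype.ext (hc.inj x x.2 y y.2 z z.2 (fun h => hy.1 (Subtype.ext h.symm))
          (fun h => hz.1 (Subtype.ext h.symm)) h)
      have h2 : (G.neighborFinset x).image (fun y : R => c x y) ⊆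
          ({i, g} : Finset ℕ).filter fun j => x.1 ∉ missing R c j := by
        intro j hj
        obtain ⟨y, hy, rfl⟩ := mem_image.1 hj
        rw [SimpleGraph.mem_neighborFinset] at hy
        refine mem_filter.2 ⟨by simpa using hy.2, fun h => ?_⟩
        exact (mem_missing.1 h).2 y y.2 (fun h => hy.1 (Subtype.ext h.symm)) rfl
      have h3 := card_le_card h2
      rw [h1, card_filter, sum_pair hig] at h3
      split_ifs at h3 ⊢ <;> omega) (by
      rw [hsum, hsum, huniv, huniv]
      exact hlt)
  rw [hsum, hsum] at hS1 hS2
  set S := S₀.map (Function.Embedding.subtype _) with hS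
  have hSR : S ⊆ R := by
    intro x hx
    obtain ⟨y, _, rfl⟩ := mem_map.1 hx
    exact y.2
  have hcl : ∀ x ∈ R, ∀ y ∈ R, x ≠ y → (c x y = i ∨ c x y = g) → (x ∈ S ↔ y ∈ S) := by
    intro x hx y hy hxy h
    have := hS₀ ⟨x, hx⟩ ⟨y, hy⟩ ⟨fun h => hxy (congrArg Subtype.val h), h⟩
    simp only [hS, mem_map, Function.Embedding.coe_subtype, Subtype.exists, exists_and_right,
      exists_eq_right]
    exact ⟨fun h => ⟨hy, this.1 h.2⟩, fun h => ⟨hx, this.2 h.2⟩⟩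
  let c' : U → U → ℕ := fun x y => if x ∈ S ∧ y ∈ S then Equiv.swap i g (c x y) else c x y
  have hcS : ∀ x ∈ S, ∀ y ∈ R, y ≠ x → c' x y = Equiv.swap i g (c x y) := by
    intro x hx y hy hyx
    by_cases hyS : y ∈ S
    · simp [c', hx, hyS]
    · have h : ¬ (c x y = i ∨ c x y = g) := fun h => hyS ((hcl x (hSR hx) y hy hyx.symm h).1 hx)
      push Not at h
      simp only [c', hx, hyS, and_false, if_false]
      rw [Equiv.swap_apply_of_ne_of_ne h.1 h.2]
  have hcnS : ∀ x, x ∉ S → ∀ y, c' x y = c x y := by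
    intro x hx y
    simp [c', hx]
  have hm : ∀ j, missing R c' j =
      (missing R c (Equiv.swap i g j) ∩ S) ∪ (missing R c j \ S) := by
    intro j
    ext x
    simp only [mem_union, mem_inter, mem_sdiff, mem_missing]
    by_cases hx : x ∈ S
    · simp only [hx, and_true, not_true_eq_false, and_false, or_false]
      refine and_congr_right fun hxR => forall₂_congr fun y hy => ?_
      refine forall_congr' fun hyx => ?_
      rw [hcS x hx y hy hyx, Ne, Ne, Equiv.swap_apply_eq_iff]
    · simp only [hx, and_false, false_or, not_false_eq_true, and_true, hcnS x hx]
  have hmc : ∀ j, #(missing R c' j) =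
      #(missing R c (Equiv.swap i g j) ∩ S) + #(missing R c j \ S) := by
    intro j
    rw [hm, card_union_of_disjoint]
    rw [Finset.disjoint_left]
    intro x h h'
    exact (mem_sdiff.1 h').2 (mem_inter.1 h).2
  have h1 := hmc i
  have h2 := hmc g
  rw [Equiv.swap_apply_left] at h1
  rw [Equiv.swap_apply_right] at h2
  have h3 := card_inter_add_card_sdiff (missing R c i) S
  have h4 := card_inter_add_card_sdiff (missing R c g) S
  refine ⟨c', ⟨?_, ?_, ?_⟩, ?_, ?_, by omega, by omega, by omega⟩
  · intro x y
    simp only [c', hc.symm x y, and_comm]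
  · intro x hx y hy hxy
    have h := hc.mem x hx y hy hxy
    by_cases hxS : x ∈ S
    · rw [hcS x hxS y hy hxy.symm, Equiv.swap_apply_def]
      split_ifs <;> assumption
    · rwa [hcnS x hxS]
  · intro x hx y hy z hz hyx hzx h
    by_cases hxS : x ∈ S
    · rw [hcS x hxS y hy hyx, hcS x hxS z hz hzx] at h
      exact hc.inj x hx y hy z hz hyx hzx (Equiv.injective _ h)
    · rw [hcnS x hxS, hcnS x hxS] at h
      exact hc.inj x hx y hy z hz hyx hzx h
  · intro x hx y hy hxy h h'
    by_cases hxS : x ∈ S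
    · rw [hcS x hxS y hy hxy.symm, Equiv.swap_apply_of_ne_of_ne h h']
    · rw [hcnS x hxS]
  · intro j hj hj'
    rw [hm, Equiv.swap_apply_of_ne_of_ne hj hj', union_comm, sdiff_union_inter]

open Finset in
/-- Recoloring the edges whose color lies in `Z` so that no color in `Z` misses more than `s`
vertices. -/
theorem ProperOn.exists_balanced {U : Type*} [DecidableEq U] {R : Finset U} {K : Finset ℕ}
    (Z : Finset ℕ) (hZ : Z ⊆ K) (s : ℕ) (hRs : Even (#R + s)) (m : ℕ) (c : U → U → ℕ)
    (hc : ProperOn R K c) (hm : ∑ i ∈ Z, (#(missing R c i) - s) ≤ m)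
    (hsum : ∑ i ∈ Z, #(missing R c i) ≤ #Z * s) :
    ∃ c', ProperOn R K c' ∧ (∀ x ∈ R, ∀ y ∈ R, x ≠ y → c x y ∉ Z → c' x y = c x y) ∧
      (∀ i ∉ Z, missing R c' i = missing R c i) ∧ ∀ i ∈ Z, #(missing R c' i) ≤ s := by
  induction m generalizing c with
  | zero =>
    refine ⟨c, hc, fun _ _ _ _ _ _ => rfl, fun _ _ => rfl, fun i hi => ?_⟩
    have := sum_eq_zero_iff.1 (Nat.le_zero.1 hm) i hi
    omega
  | succ m ih =>
    by_cases hall : ∀ i ∈ Z, #(missing R c i) ≤ s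
    · exact ⟨c, hc, fun _ _ _ _ _ _ => rfl, fun _ _ => rfl, hall⟩
    push Not at hall
    obtain ⟨g, hg, hgs⟩ := hall
    obtain ⟨i, hi, his⟩ : ∃ i ∈ Z, #(missing R c i) < s := by
      by_contra h
      push Not at h
      have := sum_lt_sum h ⟨g, hg, hgs⟩
      rw [sum_const, smul_eq_mul] at this
      omega
    obtain ⟨c₁, hc₁, h1, h2, h3, h4, h5⟩ := hc.exists_kempe_change (hZ hi) (hZ hg) (by omega)
    have hgi : g ∈ Z.erase i := mem_erase.2 ⟨by rintro rfl; omega, hg⟩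
    have hsplit : ∀ F : ℕ → ℕ, ∑ j ∈ Z, F j = ∑ j ∈ (Z.erase i).erase g, F j + F g + F i := by
      intro F
      rw [sum_erase_add _ _ hgi, sum_erase_add _ _ hi]
    have heq : ∀ F : ℕ → ℕ, ∑ j ∈ (Z.erase i).erase g, F #(missing R c₁ j) =
        ∑ j ∈ (Z.erase i).erase g, F #(missing R c j) := by
      intro F
      refine sum_congr rfl fun j hj => ?_
      rw [h2 j (ne_of_mem_erase (mem_of_mem_erase hj)) (ne_of_mem_erase hj)]
    obtain ⟨c', hc', h6, h7, h8⟩ := ih c₁ hc₁ (by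
        have h6 := heq fun k => k - s
        have h9 := hc.even_card_missing_add i
        rw [hsplit] at hm ⊢
        rw [Nat.even_iff] at hRs h9
        omega) (by
        have h6 := heq fun k => k
        rw [hsplit] at hsum ⊢
        omega)
    refine ⟨c', hc', fun x hx y hy hxy hZ' => ?_, fun j hj => ?_, h8⟩
    · have h9 := h1 x hx y hy hxy (fun h => hZ' (h ▸ hi)) (fun h => hZ' (h ▸ hg))
      rw [h6 x hx y hy hxy (h9 ▸ hZ'), h9]
    · rw [h7 j hj, h2 j (by rintro rfl; exact hj hi) (by rintro rfl; exact hj hg)]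

open Finset in
/-- A set of edges covers at most twice as many vertices. -/
theorem card_covered_le_two_mul {U : Type*} [DecidableEq U] (P : Finset (Sym2 U)) (R : Finset U)
    (hR : ∀ x ∈ R, ∃ e ∈ P, x ∈ e) : #R ≤ 2 * #P := by
  have h : R ⊆ P.biUnion Sym2.toFinset := by
    intro x hx
    obtain ⟨e, he, hxe⟩ := hR x hx
    exact mem_biUnion.2 ⟨e, he, Sym2.mem_toFinset.2 hxe⟩
  refine (card_le_card h).trans (card_biUnion_le.trans ?_)
  rw [mul_comm]
  refine sum_le_card_nsmul _ _ _ fun e _ => ?_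
  rw [Sym2.card_toFinset]
  split_ifs <;> simp

open Finset in
/-- A set of edges, none of which is disjoint from all others, covers at most `3 / 2` times as many
vertices. -/
theorem two_mul_card_covered_le {U : Type*} [DecidableEq U] (P : Finset (Sym2 U)) (R : Finset U)
    (hR : ∀ x ∈ R, ∃ e ∈ P, x ∈ e) (hP : ∀ e ∈ P, ∃ x ∈ e, ∃ f ∈ P, f ≠ e ∧ x ∈ f) :
    2 * #R ≤ 3 * #P := by
  set L : Finset U := {x ∈ R | #{e ∈ P | x ∈ e} = 1} with hL
  have hcomm : ∀ S : Finset U, ∑ x ∈ S, #{e ∈ P | x ∈ e} = ∑ e ∈ P, #{x ∈ S | x ∈ e} :=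
    fun S => sum_card_bipartiteAbove_eq_sum_card_bipartiteBelow fun x e => x ∈ e
  have hLP : #L ≤ #P := by
    have h1 : ∑ x ∈ L, #{e ∈ P | x ∈ e} = #L := by
      rw [sum_const_nat fun x hx => (mem_filter.1 hx).2, mul_one]
    rw [← h1, hcomm, ← mul_one #P]
    refine sum_le_card_nsmul _ _ _ fun e he => card_le_one.2 fun x hx y hy => ?_
    by_contra hxy
    obtain ⟨z, hze, f, hf, hfe, hzf⟩ := hP e he
    obtain ⟨hxL, hxe⟩ := mem_filter.1 hx
    obtain ⟨hyL, hye⟩ := mem_filter.1 hy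
    have hz : z ∈ L := by
      rw [(Sym2.mem_and_mem_iff hxy).1 ⟨hxe, hye⟩, Sym2.mem_iff] at hze
      rcases hze with rfl | rfl <;> assumption
    exact hfe (card_le_one.1 (mem_filter.1 hz).2.le f (mem_filter.2 ⟨hf, hzf⟩) e
      (mem_filter.2 ⟨he, hze⟩))
  have h1 : ∑ x ∈ R, #{e ∈ P | x ∈ e} ≤ #P * 2 := by
    rw [hcomm]
    refine sum_le_card_nsmul _ _ _ fun e _ => ?_
    have h : {x ∈ R | x ∈ e} ⊆ e.toFinset := fun x hx => Sym2.mem_toFinset.2 (mem_filter.1 hx).2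
    refine (card_le_card h).trans ?_
    rw [Sym2.card_toFinset]
    split_ifs <;> simp
  have h2 : ∑ x ∈ R, (2 - if #{e ∈ P | x ∈ e} = 1 then 1 else 0) ≤ ∑ x ∈ R, #{e ∈ P | x ∈ e} := by
    refine sum_le_sum fun x hx => ?_
    obtain ⟨e, he, hxe⟩ := hR x hx
    have : 0 < #{e ∈ P | x ∈ e} := card_pos.2 ⟨e, mem_filter.2 ⟨he, hxe⟩⟩
    split_ifs <;> omega
  have h3 : ∑ x ∈ R, (2 - if #{e ∈ P | x ∈ e} = 1 then 1 else 0) + #L = #R * 2 := by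
    rw [hL, card_filter, ← sum_add_distrib]
    exact sum_const_nat fun x _ => by split_ifs <;> rfl
  omega

open Finset in
/-- In a coloring of the complete graph on `W` by `#W - 1` colors, the color-`i` edges match the
vertices of `R` missing `i` inside `R` to distinct vertices outside `R`. -/
theorem ProperOn.card_missing_add_card_le {U : Type*} [DecidableEq U] {W R T : Finset U}
    {K : Finset ℕ} {c : U → U → ℕ} (hc : ProperOn W K c) (hWK : #W = #K + 1) (hR : R ⊆ W)
    {i : ℕ} (hi : i ∈ K) (hT : T ⊆ W) (hRT : Disjoint R T)
    (hTc : ∀ x ∈ T, ∃ y ∈ W, y ∉ R ∧ y ≠ x ∧ c x y = i) :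
    #(missing R c i) + #T + #R ≤ #W := by
  have hex : ∀ x, ∃ y, x ∈ missing R c i → (y ∈ W ∧ y ∉ R ∧ y ≠ x ∧ c x y = i) := by
    intro x
    by_cases hx : x ∈ missing R c i
    · have hxW := hR (missing_subset _ _ _ hx)
      have h := hc.card_missingGraph_left hxW
      have h0 : #{e ∈ missingGraph W K c | e.1 = x} = 0 := by omega
      have h1 : x ∉ missing W c i := fun hm =>
        filter_eq_empty_iff.1 (card_eq_zero.1 h0) (mem_missingGraph.2 ⟨hi, hm⟩) rfl
      rw [mem_missing] at h1
      push Not at h1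
      obtain ⟨y, hy, hyx, hxy⟩ := h1 hxW
      exact ⟨y, fun _ => ⟨hy, fun h => (mem_missing.1 hx).2 y h hyx hxy, hyx, hxy⟩⟩
    · exact ⟨x, fun h => absurd h hx⟩
  choose τ hτ using hex
  have h1 : #((missing R c i).image τ) = #(missing R c i) := by
    refine card_image_of_injOn fun x hx y hy h => ?_
    obtain ⟨h1, -, h3, h4⟩ := hτ x hx
    obtain ⟨-, -, h5, h6⟩ := hτ y hy
    refine hc.inj (τ x) h1 x (hR (missing_subset _ _ _ hx)) y (hR (missing_subset _ _ _ hy))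
      h3.symm (h ▸ h5.symm) ?_
    rw [hc.symm, h4, hc.symm, h, h6]
  have h2 : Disjoint ((missing R c i).image τ) T := by
    rw [Finset.disjoint_left]
    intro y hy hyT
    obtain ⟨x, hx, rfl⟩ := mem_image.1 hy
    obtain ⟨h3, h4, h5, h6⟩ := hτ x hx
    obtain ⟨z, hz, hzR, hzy, h7⟩ := hTc _ hyT
    have hxR := missing_subset _ _ _ hx
    refine hzR (hc.inj (τ x) h3 z hz x (hR hxR) hzy h5.symm ?_ ▸ hxR)
    rw [h7, hc.symm, h6]
  have h3 : Disjoint ((missing R c i).image τ ∪ T) R := by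
    rw [disjoint_union_left]
    refine ⟨?_, hRT.symm⟩
    rw [Finset.disjoint_left]
    intro y hy
    obtain ⟨x, hx, rfl⟩ := mem_image.1 hy
    exact (hτ x hx).2.1
  rw [← h1, ← card_union_of_disjoint h2, ← card_union_of_disjoint h3]
  refine card_le_card (union_subset (union_subset ?_ hT) hR)
  intro y hy
  obtain ⟨x, hx, rfl⟩ := mem_image.1 hy
  exact (hτ x hx).1

open Finset in
/-- Giving the edge `{u, v}` the color `α`, and the new color `γ` to the edges that would conflict
with this. -/
theorem ProperOn.exists_recolor {U : Type*} [DecidableEq U] {R : Finset U}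
    {K K' : Finset ℕ} {c : U → U → ℕ} (hc : ProperOn R K' c) (hK : K' ⊆ K) {u v : U} (hu : u ∈ R)
    (hv : v ∈ R) (huv : u ≠ v) {α γ : ℕ} (hα : α ∈ K) (hγ : γ ∈ K) (hγ' : γ ∉ K') (hαγ : α ≠ γ) :
    ∃ c', ProperOn R K c' ∧ c' u v = α ∧
      (∀ x y, s(x, y) ≠ s(u, v) → (c x y = α → x ∉ s(u, v) ∧ y ∉ s(u, v)) → c' x y = c x y) ∧
      (∀ i ∈ K', #(missing R c' i) ≤ #(missing R c i) + 2) ∧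
      ∀ i ∈ K', i ≠ α → i ≠ c u v → #(missing R c' i) ≤ #(missing R c i) := by
  let c' : U → U → ℕ := fun x y =>
    if s(x, y) = s(u, v) then α
    else if c x y = α ∧ (x ∈ s(u, v) ∨ y ∈ s(u, v)) then γ else c x y
  have hedge : ∀ {x y}, s(x, y) = s(u, v) → c' x y = α := fun h => by simp only [c', if_pos h]
  have hmid : ∀ {x y}, s(x, y) ≠ s(u, v) → c x y = α → (x ∈ s(u, v) ∨ y ∈ s(u, v)) →
      c' x y = γ := fun h h1 h2 => by simp only [c', if_neg h, if_pos (And.intro h1 h2)]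
  have hrest : ∀ x y, s(x, y) ≠ s(u, v) → (c x y = α → x ∉ s(u, v) ∧ y ∉ s(u, v)) →
      c' x y = c x y := by
    intro x y h h'
    simp only [c', if_neg h]
    rw [if_neg]
    rintro ⟨h1, h2⟩
    have := h' h1
    tauto
  have hcase : ∀ x y, (s(x, y) = s(u, v) ∧ c' x y = α) ∨
      (s(x, y) ≠ s(u, v) ∧ c x y = α ∧ (x ∈ s(u, v) ∨ y ∈ s(u, v)) ∧ c' x y = γ) ∨
      (s(x, y) ≠ s(u, v) ∧ (c x y = α → x ∉ s(u, v) ∧ y ∉ s(u, v)) ∧ c' x y = c x y) := by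
    intro x y
    by_cases h : s(x, y) = s(u, v)
    · exact Or.inl ⟨h, hedge h⟩
    by_cases h' : c x y = α ∧ (x ∈ s(u, v) ∨ y ∈ s(u, v))
    · exact Or.inr (Or.inl ⟨h, h'.1, h'.2, hmid h h'.1 h'.2⟩)
    · exact Or.inr (Or.inr ⟨h, by tauto, hrest x y h (by tauto)⟩)
  have hinj : ∀ x ∈ R, ∀ y ∈ R, ∀ z ∈ R, y ≠ x → z ≠ x → s(x, y) = s(u, v) →
      c' x y = c' x z → y = z := by
    intro x hx y hy z hz hyx hzx he h
    rw [hedge he] at h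
    rcases hcase x z with ⟨h1, -⟩ | ⟨-, -, -, h1⟩ | ⟨h1, h2, h3⟩
    · exact Sym2.congr_right.1 (he.trans h1.symm)
    · exact absurd (h.trans h1) hαγ
    · exact absurd (he ▸ Sym2.mem_mk_left x y) (h2 (h3.symm.trans h.symm)).1
  have huvm : ∀ x, x ∈ s(u, v) → x ∉ missing R c' α := by
    intro x hx hm
    rcases Sym2.mem_iff.1 hx with rfl | rfl
    · exact (mem_missing.1 hm).2 v hv huv.symm (hedge rfl)
    · exact (mem_missing.1 hm).2 u hu huv (hedge Sym2.eq_swap)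
  have hseen : ∀ i, ∀ x ∈ missing R c' i, x ∉ missing R c i → ∃ y ∈ R, y ≠ x ∧ c x y = i ∧
      (s(x, y) = s(u, v) ∨ i = α ∧ y ∈ s(u, v)) := by
    intro i x hx hx'
    have hxR := missing_subset _ _ _ hx
    rw [mem_missing] at hx'
    push Not at hx'
    obtain ⟨y, hy, hyx, hxy⟩ := hx' hxR
    refine ⟨y, hy, hyx, hxy, ?_⟩
    rcases hcase x y with ⟨h1, -⟩ | ⟨-, h1, h2, -⟩ | ⟨-, -, h1⟩
    · exact Or.inl h1
    · have hiα : i = α := hxy.symm.trans h1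
      subst hiα
      exact Or.inr ⟨rfl, h2.resolve_left fun h => huvm x h hx⟩
    · exact absurd (h1.trans hxy) ((mem_missing.1 hx).2 y hy hyx)
  refine ⟨c', ⟨?_, ?_, ?_⟩, hedge rfl, hrest, ?_, ?_⟩
  · intro x y
    simp only [c', hc.symm x y, Sym2.eq_swap (a := x) (b := y), or_comm]
  · intro x hx y hy hxy
    rcases hcase x y with ⟨-, h⟩ | ⟨-, -, -, h⟩ | ⟨-, -, h⟩ <;> rw [h]
    · exact hα
    · exact hγ
    · exact hK (hc.mem x hx y hy hxy)
  · intro x hx y hy z hz hyx hzx h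
    rcases hcase x y with ⟨h1, -⟩ | ⟨-, h1, -, h2⟩ | ⟨-, -, h1⟩
    · exact hinj x hx y hy z hz hyx hzx h1 h
    all_goals rcases hcase x z with ⟨h3, -⟩ | ⟨-, h3, -, h4⟩ | ⟨-, -, h3⟩
    · exact (hinj x hx z hz y hy hzx hyx h3 h.symm).symm
    · exact hc.inj x hx y hy z hz hyx hzx (h1.trans h3.symm)
    · rw [h2, h3] at h
      exact absurd (h ▸ hc.mem x hx z hz hzx.symm) hγ'
    · exact (hinj x hx z hz y hy hzx hyx h3 h.symm).symm
    · rw [h1, h4] at h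
      exact absurd (h ▸ hc.mem x hx y hy hyx.symm) hγ'
    · rw [h1, h3] at h
      exact hc.inj x hx y hy z hz hyx hzx h
  · intro i _
    have hsub : ∃ D : Finset U, #D ≤ 2 ∧ missing R c' i ⊆ missing R c i ∪ D := by
      by_cases hiα : i = α
      · subst hiα
        have hD : ∀ w ∈ R, #{x ∈ R | w ≠ x ∧ c x w = i} ≤ 1 := by
          intro w hw
          refine card_le_one.2 fun x hx y hy => ?_
          obtain ⟨hx, hwx, hxw⟩ := mem_filter.1 hx
          obtain ⟨hy, hwy, hyw⟩ := mem_filter.1 hy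
          exact hc.inj w hw x hx y hy hwx.symm hwy.symm (by rw [hc.symm, hxw, hc.symm, hyw])
        refine ⟨{x ∈ R | u ≠ x ∧ c x u = i} ∪ {x ∈ R | v ≠ x ∧ c x v = i},
          (card_union_le _ _).trans (Nat.add_le_add (hD u hu) (hD v hv)), ?_⟩
        intro x hx
        by_cases hx' : x ∈ missing R c i
        · exact mem_union_left _ hx'
        obtain ⟨y, hy, hyx, hxy, h⟩ := hseen i x hx hx'
        have hxR := missing_subset _ _ _ hx
        refine mem_union_right _ (mem_union.2 ?_)
        have hyuv : y ∈ s(u, v) := by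
          rcases h with h | h
          · exact h ▸ Sym2.mem_mk_right x y
          · exact h.2
        rcases Sym2.mem_iff.1 hyuv with rfl | rfl
        · exact Or.inl (mem_filter.2 ⟨hxR, hyx, hxy⟩)
        · exact Or.inr (mem_filter.2 ⟨hxR, hyx, hxy⟩)
      · refine ⟨{u, v}, card_le_two, fun x hx => ?_⟩
        by_cases hx' : x ∈ missing R c i
        · exact mem_union_left _ hx'
        obtain ⟨y, hy, hyx, hxy, h⟩ := hseen i x hx hx'
        have h1 := h.resolve_right fun h => hiα h.1
        have h2 := h1 ▸ Sym2.mem_mk_left x y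
        exact mem_union_right _ (by simpa using h2)
    obtain ⟨D, hD, hsub⟩ := hsub
    exact (card_le_card hsub).trans ((card_union_le _ _).trans (Nat.add_le_add_left hD _))
  · intro i _ hiα hiuv
    refine card_le_card fun x hx => ?_
    by_contra hx'
    obtain ⟨y, hy, hyx, hxy, h⟩ := hseen i x hx hx'
    rcases Sym2.eq_iff.1 (h.resolve_right fun h => hiα h.1) with ⟨rfl, rfl⟩ | ⟨rfl, rfl⟩
    · exact hiuv hxy.symm
    · exact hiuv (hxy.symm.trans (hc.symm _ _))

open Finset in
/-- If some coloring of the complete graph on the vertices of the non-isolated edges in `P` extends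
the precoloring there and its colors miss few vertices, then the precoloring extends to `W`.
Here `I` is the set of isolated edges in `P`. -/
theorem exists_extension_of_core {U : Type*} [DecidableEq U] {W : Finset U} {K : Finset ℕ}
    (hWK : #W = #K + 1) (hW : Even #W) {P : Finset (Sym2 U)} {p : Sym2 U → ℕ}
    (hPW : ∀ e ∈ P, ¬ e.IsDiag ∧ ∀ v ∈ e, v ∈ W) (hPK : ∀ e ∈ P, p e ∈ K) {R T : Finset U}
    (hR : R ⊆ W) (hT : T ⊆ W) (hRT : Disjoint R T) (hRTW : #R + #T + 2 ≤ #W) {σ : U → U}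
    (hσ : ∀ x ∈ T, σ x ∈ T ∧ s(x, σ x) ∈ P ∧ ∀ e ∈ P, x ∈ e → e = s(x, σ x))
    (hP : ∀ e ∈ P, (∀ v ∈ e, v ∈ R) ∨ ∀ v ∈ e, v ∈ T) {c : U → U → ℕ} (hc : ProperOn R K c)
    (hcp : ∀ x ∈ R, ∀ y ∈ R, s(x, y) ∈ P → c x y = p s(x, y))
    (hd : ∀ i ∈ K, #(missing R c i) + #{x ∈ T | p s(x, σ x) = i} + #R ≤ #W) :
    ∃ c', ProperOn W K c' ∧ ∀ x y, s(x, y) ∈ P → c' x y = p s(x, y) := by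
  have hσσ : ∀ x ∈ T, σ (σ x) = x := by
    intro x hx
    obtain ⟨h1, h2, -⟩ := hσ x hx
    have h := (hσ (σ x) h1).2.2 _ h2 (Sym2.mem_mk_right _ _)
    rw [Sym2.eq_swap] at h
    exact (Sym2.congr_right.1 h).symm
  obtain ⟨c', h1, h2, h3⟩ := exists_extension_of_pairs hWK hW σ (fun x => p s(x, σ x)) #T T le_rfl
    hT (by
      intro x hx
      obtain ⟨h1, h2, -⟩ := hσ x hx
      refine ⟨⟨h1, fun h => (hPW _ h2).1 (Sym2.mk_isDiag_iff.2 h.symm), hσσ x hx⟩, hPK _ h2, ?_⟩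
      rw [hσσ x hx, Sym2.eq_swap]) (#W - #R) R hR hRT c (by omega) (by omega) hc
    (fun i hi => by have := hd i hi; omega)
  refine ⟨c', h1, fun x y hxy => ?_⟩
  rcases hP _ hxy with h | h
  · have hx := h x (Sym2.mem_mk_left _ _)
    have hy := h y (Sym2.mem_mk_right _ _)
    rw [h2 x hx y hy, hcp x hx y hy hxy]
  · have hx := h x (Sym2.mem_mk_left _ _)
    have h4 := Sym2.congr_right.1 ((hσ x hx).2.2 _ hxy (Sym2.mem_mk_left _ _))
    rw [h4, h3 x hx]

open Finset in
/-- A proper precoloring of at most `n - 1` edges of the complete graph on `2 * n` vertices extends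
to a proper coloring with `2 * n - 1` colors. -/
theorem exists_extension_of_precoloring {U : Type*} [DecidableEq U] (n : ℕ) (W : Finset U)
    (K : Finset ℕ) (P : Finset (Sym2 U)) (p : Sym2 U → ℕ) (hW : #W = 2 * n) (hK : #K + 1 = 2 * n)
    (hPW : ∀ e ∈ P, ¬ e.IsDiag ∧ ∀ v ∈ e, v ∈ W) (hPn : #P + 1 ≤ n) (hPK : ∀ e ∈ P, p e ∈ K)
    (hp : ∀ e ∈ P, ∀ f ∈ P, e ≠ f → ∀ v ∈ e, v ∈ f → p e ≠ p f) :
    ∃ c, ProperOn W K c ∧ ∀ x y, s(x, y) ∈ P → c x y = p s(x, y) := by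
  induction n generalizing W K P with
  | zero => omega
  | succ n ih =>
  classical
  set I : Finset (Sym2 U) := {e ∈ P | ∀ f ∈ P, f ≠ e → ∀ v ∈ e, v ∉ f} with hI
  set Q : Finset (Sym2 U) := P \ I with hQ
  have hIP : I ⊆ P := filter_subset _ _
  have hIQ : #Q + #I = #P := card_sdiff_add_card_eq_card hIP
  set T : Finset U := {x ∈ W | ∃ e ∈ I, x ∈ e} with hT
  set R : Finset U := {x ∈ W | ∃ e ∈ Q, x ∈ e} with hR
  have hTW : T ⊆ W := filter_subset _ _
  have hRW : R ⊆ W := filter_subset _ _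
  have hRT : Disjoint R T := by
    rw [Finset.disjoint_left]
    intro x hx hx'
    obtain ⟨e, he, hxe⟩ := (mem_filter.1 hx).2
    obtain ⟨f, hf, hxf⟩ := (mem_filter.1 hx').2
    obtain ⟨heP, heI⟩ := mem_sdiff.1 he
    exact (mem_filter.1 hf).2 e heP (by rintro rfl; exact heI hf) x hxf hxe
  have hQadj : ∀ e ∈ Q, ∃ x ∈ e, ∃ f ∈ Q, f ≠ e ∧ x ∈ f := by
    intro e he
    obtain ⟨heP, heI⟩ := mem_sdiff.1 he
    rw [hI, mem_filter] at heI
    push Not at heI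
    obtain ⟨f, hf, hfe, v, hve, hvf⟩ := heI heP
    exact ⟨v, hve, f, mem_sdiff.2 ⟨hf, fun h => (mem_filter.1 h).2 e heP hfe.symm v hvf hve⟩, hfe,
      hvf⟩
  have hTI : #T ≤ 2 * #I := card_covered_le_two_mul I T fun x hx => (mem_filter.1 hx).2
  have hRQ : 2 * #R ≤ 3 * #Q := two_mul_card_covered_le Q R (fun x hx => (mem_filter.1 hx).2) hQadj
  have hσ : ∀ x, ∃ y, x ∈ T → y ∈ T ∧ s(x, y) ∈ I := by
    intro x
    by_cases hx : x ∈ T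
    · obtain ⟨e, he, y, rfl⟩ := (mem_filter.1 hx).2
      exact ⟨y, fun _ => ⟨mem_filter.2 ⟨(hPW _ (hIP he)).2 _ (Sym2.mem_mk_right _ _), _, he,
        Sym2.mem_mk_right _ _⟩, he⟩⟩
    · exact ⟨x, fun h => absurd h hx⟩
  choose σ hσ using hσ
  suffices h : ∃ c, ProperOn R K c ∧ (∀ x ∈ R, ∀ y ∈ R, s(x, y) ∈ P → c x y = p s(x, y)) ∧
      ∀ i ∈ K, #(missing R c i) + #{x ∈ T | p s(x, σ x) = i} + #R ≤ #W by
    obtain ⟨c, hc, hcp, hd⟩ := h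
    refine exists_extension_of_core (by omega) (by rw [hW]; exact even_two_mul _) hPW hPK hRW hTW
      hRT (by omega) (σ := σ) (fun x hx => ?_) (fun e he => ?_) hc hcp hd
    · obtain ⟨h1, h2⟩ := hσ x hx
      refine ⟨h1, hIP h2, fun e he hxe => ?_⟩
      by_contra hne
      exact (mem_filter.1 h2).2 e he hne x (Sym2.mem_mk_left _ _) hxe
    · by_cases heI : e ∈ I
      · exact Or.inr fun v hv => mem_filter.2 ⟨(hPW e he).2 v hv, e, heI, hv⟩
      · exact Or.inl fun v hv => mem_filter.2 ⟨(hPW e he).2 v hv, e, mem_sdiff.2 ⟨he, heI⟩, hv⟩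
  obtain hQe | ⟨e, he⟩ := Q.eq_empty_or_nonempty
  · have hRe : R = ∅ := by
      rw [hR, hQe]
      simp
    rw [hRe]
    refine ⟨fun _ _ => 0, ⟨fun _ _ => rfl, by simp, by simp⟩, by simp, fun i _ => ?_⟩
    have := card_filter_le T fun x => p s(x, σ x) = i
    simp only [missing, filter_empty, card_empty]
    omega
  obtain ⟨heP, heI⟩ := mem_sdiff.1 he
  obtain ⟨-, -, f, hf, hfe, -⟩ := hQadj e he
  have hP2 : 2 ≤ #P := one_lt_card.2 ⟨f, sdiff_subset hf, e, heP, hfe⟩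
  induction e using Sym2.ind with | _ u v
  have heR : ∀ x ∈ s(u, v), x ∈ R := fun x hx => mem_filter.2 ⟨(hPW _ heP).2 x hx, _, he, hx⟩
  have huv : u ≠ v := fun h => (hPW _ heP).1 (Sym2.mk_isDiag_iff.2 h)
  obtain ⟨y, hy, z, hz, hyz⟩ := (one_lt_card (s := W \ (R ∪ T))).1 (by
    have h1 := card_sdiff_add_card_eq_card (union_subset hRW hTW)
    have h2 := card_union_le R T
    omega)
  set Z : Finset ℕ := K \ P.image p with hZ
  have hZK : Z ⊆ K := sdiff_subset
  have hZc : n + 1 ≤ #Z := by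
    have h1 := card_sdiff_add_card_eq_card (s := P.image p) (t := K) (by
      intro i hi
      obtain ⟨e, he, rfl⟩ := mem_image.1 hi
      exact hPK e he)
    have h2 := card_image_le (s := P) (f := p)
    rw [← hZ] at h1
    omega
  have hZP : ∀ e ∈ P, p e ∉ Z := fun e he h => (mem_sdiff.1 h).2 (mem_image_of_mem _ he)
  obtain ⟨γ, hγ, δ, hδ, hγδ⟩ := (one_lt_card (s := Z)).1 (by omega)
  set W' := (W.erase y).erase z with hW'
  set K' := (K.erase γ).erase δ with hK'
  have hcW' : #W' + 2 = #W := by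
    rw [← card_erase_add_one (mem_sdiff.1 hy).1,
      ← card_erase_add_one (mem_erase.2 ⟨hyz.symm, (mem_sdiff.1 hz).1⟩)]
  have hcK' : #K' + 2 = #K := by
    rw [← card_erase_add_one (hZK hγ), ← card_erase_add_one (mem_erase.2 ⟨hγδ.symm, hZK hδ⟩)]
  have hsubW : R ∪ T ⊆ W' := fun x hx => mem_erase.2 ⟨by rintro rfl; exact (mem_sdiff.1 hz).2 hx,
    mem_erase.2 ⟨by rintro rfl; exact (mem_sdiff.1 hy).2 hx, union_subset hRW hTW hx⟩⟩
  have hRW' : R ⊆ W' := subset_union_left.trans hsubW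
  have hTW' : T ⊆ W' := subset_union_right.trans hsubW
  have hK'K : K' ⊆ K := (erase_subset _ _).trans (erase_subset _ _)
  have hPK' : ∀ e ∈ P, p e ∈ K' := fun e he => mem_erase.2 ⟨fun h => hZP e he (h ▸ hδ),
    mem_erase.2 ⟨fun h => hZP e he (h ▸ hγ), hPK e he⟩⟩
  obtain ⟨c, hc, hcp⟩ := ih W' K' (P.erase s(u, v)) (by omega) (by omega) (by
      intro e he
      have he := mem_of_mem_erase he
      refine ⟨(hPW e he).1, fun x hx => hsubW (mem_union.2 ?_)⟩
      by_cases heI : e ∈ I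
      · exact Or.inr (mem_filter.2 ⟨(hPW e he).2 x hx, e, heI, hx⟩)
      · exact Or.inl (mem_filter.2 ⟨(hPW e he).2 x hx, e, mem_sdiff.2 ⟨he, heI⟩, hx⟩))
    (by rw [card_erase_of_mem heP]; omega) (fun e he => hPK' e (mem_of_mem_erase he))
    (fun e he f hf => hp e (mem_of_mem_erase he) f (mem_of_mem_erase hf))
  have hcR : ProperOn R K' c := ⟨hc.symm, fun x hx y hy => hc.mem x (hRW' hx) y (hRW' hy),
    fun x hx y hy z hz => hc.inj x (hRW' hx) y (hRW' hy) z (hRW' hz)⟩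
  have hdc : ∀ i ∈ K', #(missing R c i) + #{x ∈ T | p s(x, σ x) = i} + #R ≤ #W' := by
    intro i hi
    refine hc.card_missing_add_card_le (by omega) hRW' hi ((filter_subset _ _).trans hTW')
      (hRT.mono_right (filter_subset _ _)) fun x hx => ?_
    obtain ⟨hx, hxi⟩ := mem_filter.1 hx
    obtain ⟨h1, h2⟩ := hσ x hx
    refine ⟨σ x, hTW' h1, disjoint_right.1 hRT h1, ?_, ?_⟩
    · exact fun h => (hPW _ (hIP h2)).1 (Sym2.mk_isDiag_iff.2 h.symm)
    · rw [hcp x (σ x) (mem_erase.2 ⟨fun h => heI (h ▸ h2), hIP h2⟩), hxi]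
  obtain ⟨c₁, hc₁, huv₁, h1, h2, h3⟩ := hcR.exists_recolor hK'K (heR u (Sym2.mem_mk_left _ _))
    (heR v (Sym2.mem_mk_right _ _)) huv (hPK _ heP) (hZK hγ) (by simp [hK'])
    (fun h => hZP _ heP (h ▸ hγ))
  have hc₁p : ∀ x y, s(x, y) ∈ P → c₁ x y = p s(x, y) := by
    intro x y hxy
    by_cases hxe : s(x, y) = s(u, v)
    · rw [hxe]
      rcases Sym2.eq_iff.1 hxe with ⟨rfl, rfl⟩ | ⟨rfl, rfl⟩
      · exact huv₁
      · rw [hc₁.symm, huv₁]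
    · have h4 := hcp x y (mem_erase.2 ⟨hxe, hxy⟩)
      rw [h1 x y hxe, h4]
      intro h5
      rw [h4] at h5
      exact ⟨fun h => hp _ hxy _ heP hxe x (Sym2.mem_mk_left _ _) h h5,
        fun h => hp _ hxy _ heP hxe y (Sym2.mem_mk_right _ _) h h5⟩
  have hRW2 : #R + 2 ≤ #W := by
    have := card_le_card hRW'
    omega
  obtain ⟨c₂, hc₂, h4, h5, h6⟩ := hc₁.exists_balanced Z hZK (#W - #R) (by
      rw [show #R + (#W - #R) = #W by omega, hW]
      exact even_two_mul _) _ c₁ le_rfl (by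
      have h7 : #((Z.erase γ).erase δ) + 2 = #Z := by
        rw [← card_erase_add_one hγ, ← card_erase_add_one (mem_erase.2 ⟨hγδ.symm, hδ⟩)]
      rw [← sum_erase_add _ _ hγ, ← sum_erase_add _ _ (mem_erase.2 ⟨hγδ.symm, hδ⟩)]
      have h8 := card_le_card (missing_subset R c₁ γ)
      have h9 := card_le_card (missing_subset R c₁ δ)
      have h10 : ∑ i ∈ (Z.erase γ).erase δ, #(missing R c₁ i) ≤
          ∑ i ∈ (Z.erase γ).erase δ, ((#W - #R - 2) + if i = c u v then 2 else 0) := by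
        refine sum_le_sum fun i hi => ?_
        have hiZ := mem_of_mem_erase (mem_of_mem_erase hi)
        have hiK' : i ∈ K' := erase_subset_erase _ (erase_subset_erase _ hZK) hi
        have h11 := h2 i hiK'
        have h12 := h3 i hiK' (fun h => hZP _ heP (h ▸ hiZ))
        have h13 := hdc i hiK'
        split_ifs with h
        · omega
        · have := h12 h
          omega
      rw [sum_add_distrib, sum_const, smul_eq_mul, sum_ite_eq'] at h10
      have h11 : (if c u v ∈ (Z.erase γ).erase δ then 2 else 0) ≤ 2 := by split_ifs <;> simp
      obtain ⟨s, hs⟩ := Nat.exists_eq_add_of_le hRW2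
      rw [show #W - #R - 2 = s by omega] at h10
      rw [show #W - #R = s + 2 by omega, ← h7]
      have : (#((Z.erase γ).erase δ) + 2) * (s + 2) = #((Z.erase γ).erase δ) * s +
          2 * #((Z.erase γ).erase δ) + 2 * s + 4 := by ring
      omega)
  refine ⟨c₂, hc₂, fun x hx y hy hxy => ?_, fun i hi => ?_⟩
  · have h7 := hc₁p x y hxy
    rw [h4 x hx y hy (fun h => (hPW _ hxy).1 (Sym2.mk_isDiag_iff.2 h)) (h7 ▸ hZP _ hxy), h7]
  · by_cases hiZ : i ∈ Z
    · have h7 : #{x ∈ T | p s(x, σ x) = i} = 0 := by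
        rw [card_eq_zero, filter_eq_empty_iff]
        rintro x hx rfl
        exact hZP _ (hIP (hσ x hx).2) hiZ
      have := h6 i hiZ
      omega
    · have hiK' : i ∈ K' := mem_erase.2 ⟨by rintro rfl; exact hiZ hδ,
        mem_erase.2 ⟨by rintro rfl; exact hiZ hγ, hi⟩⟩
      rw [h5 i hiZ]
      have := h2 i hiK'
      have := hdc i hiK'
      omega

theorem stmt10 (n : ℕ) (hn : 2 ≤ n) (φ : Sym2 (Fin (2*n)) → Option ℕ)
    (hφ : IsPartialProperEdgeColoring ⊤ φ) (hc : UsesColors φ (2*n-1))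
    (hcard : (Precolored φ).ncard ≤ n - 1) :
    Extendable (⊤ : SimpleGraph (Fin (2*n))) φ (2*n-1) := by
  have hP : ∀ e, e ∈ (Precolored φ).toFinite.toFinset ↔ ∃ a, φ e = some a := fun e => by
    rw [Set.Finite.mem_toFinset]
    exact Option.ne_none_iff_exists'
  have hdiag : ∀ e a, φ e = some a → ¬ e.IsDiag := fun e a h => by
    simpa using hφ.1 e (by simp [h])
  rw [Set.ncard_eq_toFinset_card _ (Precolored φ).toFinite] at hcard
  obtain ⟨c, h, hcφ⟩ := exists_extension_of_precoloring n Finset.univ (Finset.range (2 * n - 1))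
    (Precolored φ).toFinite.toFinset (fun e => (φ e).getD 0) (by simp)
    (by rw [Finset.card_range]; omega)
    (fun e he => by
      obtain ⟨a, ha⟩ := (hP e).1 he
      exact ⟨hdiag e a ha, fun _ _ => Finset.mem_univ _⟩)
    (by omega)
    (fun e he => by
      obtain ⟨a, ha⟩ := (hP e).1 he
      simpa [ha] using hc e a ha)
    (fun e he f hf hef v hve hvf => by
      obtain ⟨a, ha⟩ := (hP e).1 he
      obtain ⟨b, hb⟩ := (hP f).1 hf
      have := hφ.2 ⟨hφ.1 e (by simp [ha]), hφ.1 f (by simp [hb]), hef, v, hve, hvf⟩ (by simp [ha])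
      simpa [ha, hb] using this)
  refine ⟨Sym2.lift ⟨c, h.symm⟩, ?_, ?_, ?_⟩
  · rintro e f ⟨he, hf, hef, v, ⟨x, rfl⟩, ⟨y, rfl⟩⟩ hxy
    rw [SimpleGraph.mem_edgeSet, SimpleGraph.top_adj] at he hf
    exact hef (congrArg _ (h.inj v (Finset.mem_univ _) x (Finset.mem_univ _) y (Finset.mem_univ _)
      he.symm hf.symm hxy))
  · intro e he
    induction e using Sym2.ind with | _ x y
    rw [SimpleGraph.mem_edgeSet, SimpleGraph.top_adj] at he
    exact Finset.mem_range.1 (h.mem x (Finset.mem_univ _) y (Finset.mem_univ _) he)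
  · intro e a ha
    induction e using Sym2.ind with | _ x y
    have := hcφ x y ((hP _).2 ⟨a, ha⟩)
    rw [ha] at this
    exact this
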